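/- arXiv:2102.05490 — 9 statements merged into one kernel-verified Lean document; each statement's English description precedes it below -/
import Mathlib

section
/- Under the stated finite-abstraction and kernel hypotheses (in particular the (ε,δ)-approximate probabilistic relation encoded by conditions (i) and (ii) on κ), for every Markov policy ρ over horizon H one has μ_H({(x, x̂, q) | q ∈ F}) ≥ V̄^ρ_H(x̂₀, q̄₀). Since the q-component is frozen once it enters F, the left-hand side equals the probability that the controlled original system reaches an accepting DFA state within H steps (Theorem 1 of the paper). -/
set_option autoImplicit false

open Finset MeasureTheory

attribute [local instance] Classical.propDecidable

noncomputable section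

variable {p : ℕ} {X Xh A Q U : Type*}

/-- The set `Q'_ε(q, x̂')` of DFA successor states compatible with
the abstract state `x̂'` up to output precision `ε`. -/
def Qeps (h : X → EuclideanSpace ℝ (Fin p)) (hh : Xh → EuclideanSpace ℝ (Fin p))
    (L : EuclideanSpace ℝ (Fin p) → A) (τ : Q → A → Q) (ε : ℝ) [Fintype Q]
    (q : Q) (x' : Xh) : Finset Q :=
  Finset.univ.filter fun q' => ∃ x : X, q' = τ q (L (h x)) ∧ ‖h x - hh x'‖ ≤ ε

lemma Qeps_nonempty (h : X → EuclideanSpace ℝ (Fin p)) (hh : Xh → EuclideanSpace ℝ (Fin p))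
    (L : EuclideanSpace ℝ (Fin p) → A) (τ : Q → A → Q) (ε : ℝ) [Fintype Q]
    (hcov : ∀ x' : Xh, ∃ x : X, ‖h x - hh x'‖ ≤ ε) (q : Q) (x' : Xh) :
    (Qeps h hh L τ ε q x').Nonempty := by
  obtain ⟨x, hx⟩ := hcov x'
  exact ⟨τ q (L (h x)), Finset.mem_filter.2 ⟨Finset.mem_univ _, ⟨x, rfl, hx⟩⟩⟩

/-- Robust cost-to-go functions `V̄^ρ_n` for a Markov policy `ρ` over horizon `H`. -/
def Vbar [Fintype Q] [Fintype Xh]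
    (h : X → EuclideanSpace ℝ (Fin p)) (hh : Xh → EuclideanSpace ℝ (Fin p))
    (L : EuclideanSpace ℝ (Fin p) → A) (τ : Q → A → Q) (ε : ℝ)
    (hQ : ∀ (q : Q) (x' : Xh), (Qeps h hh L τ ε q x').Nonempty)
    (That : Xh → U → Xh → ℝ) (F : Set Q) (δ : ℝ) (H : ℕ) (ρ : ℕ → Xh × Q → U) :
    ℕ → Xh × Q → ℝ
  | 0, s => if s.2 ∈ F then 1 else 0
  | n + 1, s =>
      if s.2 ∈ F then 1
      else (1 - δ) * ∑ x' : Xh,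
        ((Qeps h hh L τ ε s.2 x').inf' (hQ s.2 x')
          fun q' => Vbar h hh L τ ε hQ That F δ H ρ n (x', q'))
        * That s.1 (ρ (H - n - 1) s) x'

/-- Violation cost-to-go functions `V̲^ρ_n` for a Markov policy `ρ` over horizon `H`. -/
def Vunder [Fintype Q] [Fintype Xh]
    (h : X → EuclideanSpace ℝ (Fin p)) (hh : Xh → EuclideanSpace ℝ (Fin p))
    (L : EuclideanSpace ℝ (Fin p) → A) (τ : Q → A → Q) (ε : ℝ)
    (hQ : ∀ (q : Q) (x' : Xh), (Qeps h hh L τ ε q x').Nonempty)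
    (That : Xh → U → Xh → ℝ) (F : Set Q) (δ : ℝ) (H : ℕ) (ρ : ℕ → Xh × Q → U) :
    ℕ → Xh × Q → ℝ
  | 0, s => if s.2 ∈ F then 1 else 0
  | n + 1, s =>
      if s.2 ∈ F then 1
      else (1 - δ) * (∑ x' : Xh,
        ((Qeps h hh L τ ε s.2 x').sup' (hQ s.2 x')
          fun q' => Vunder h hh L τ ε hQ That F δ H ρ n (x', q'))
        * That s.1 (ρ (H - n - 1) s) x') + δ

/-- The distribution `μ_k` of the controlled product process `(x, x̂, q)`:
`μ_0` is Dirac at the initial state, and at each step the `q`-component is frozen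
once in `F`, otherwise the pair `(x, x̂)` evolves through the lifted kernel `κ`
and `q` through the DFA transition on the label of the new concrete output. -/
def muSeq [MeasurableSpace X] [MeasurableSpace Xh] [MeasurableSpace Q]
    (h : X → EuclideanSpace ℝ (Fin p)) (L : EuclideanSpace ℝ (Fin p) → A)
    (τ : Q → A → Q) (F : Set Q)
    (κ : X × Xh → U → Measure (X × Xh)) (ρ : ℕ → Xh × Q → U)
    (init : X × Xh × Q) : ℕ → Measure (X × Xh × Q)
  | 0 => Measure.dirac init
  | k + 1 => (muSeq h L τ F κ ρ init k).bind fun s =>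
      if s.2.2 ∈ F then Measure.dirac s
      else (κ (s.1, s.2.1) (ρ k (s.2.1, s.2.2))).map
        fun y : X × Xh => (y.1, y.2, τ s.2.2 (L (h y.1)))

def stepK [MeasurableSpace X] [MeasurableSpace Xh] [MeasurableSpace Q]
    (h : X → EuclideanSpace ℝ (Fin p)) (L : EuclideanSpace ℝ (Fin p) → A)
    (τ : Q → A → Q) (F : Set Q)
    (κ : X × Xh → U → Measure (X × Xh)) (r : Xh × Q → U) (s : X × Xh × Q) :
    Measure (X × Xh × Q) :=
  if s.2.2 ∈ F then Measure.dirac s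
  else (κ (s.1, s.2.1) (r (s.2.1, s.2.2))).map
    fun y : X × Xh => (y.1, y.2, τ s.2.2 (L (h y.1)))

lemma measurable_next [MeasurableSpace X] [MeasurableSpace Xh] [MeasurableSpace Q]
    [MeasurableSpace A] [DiscreteMeasurableSpace A]
    (h : X → EuclideanSpace ℝ (Fin p)) (L : EuclideanSpace ℝ (Fin p) → A)
    (τ : Q → A → Q) (hL : Measurable fun x : X => L (h x)) (q : Q) :
    Measurable fun y : X × Xh => (y.1, y.2, τ q (L (h y.1))) := by
  have h1 : Measurable (τ q) := Measurable.of_discrete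
  exact measurable_fst.prodMk (measurable_snd.prodMk (h1.comp (hL.comp measurable_fst)))

lemma measurable_stepK [Finite Xh] [Finite Q]
    [MeasurableSpace X] [MeasurableSpace A] [DiscreteMeasurableSpace A]
    [MeasurableSpace Xh] [DiscreteMeasurableSpace Xh]
    [MeasurableSpace Q] [DiscreteMeasurableSpace Q]
    (h : X → EuclideanSpace ℝ (Fin p)) (L : EuclideanSpace ℝ (Fin p) → A)
    (τ : Q → A → Q) (F : Set Q) (hL : Measurable fun x : X => L (h x))
    (κ : X × Xh → U → Measure (X × Xh))
    (hκmeas : ∀ u : U, Measurable fun s : X × Xh => κ s u) (r : Xh × Q → U) :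
    Measurable (stepK h L τ F κ r) := by
  apply measurable_from_prod_countable_left
  rintro ⟨xh, q⟩
  by_cases hq : q ∈ F
  · simp only [stepK, hq, if_true]
    exact Measure.measurable_dirac.comp measurable_prodMk_right
  · simp only [stepK, hq, if_false]
    exact (Measure.measurable_map _ (measurable_next h L τ hL q)).comp
      ((hκmeas (r (xh, q))).comp measurable_prodMk_right)

theorem statement0
    (hp : 1 ≤ p) [Nonempty X] [Fintype Xh] [Nonempty Xh] [Fintype A] [Fintype Q]
    [Fintype U] [Nonempty U]
    (h : X → EuclideanSpace ℝ (Fin p)) (hh : Xh → EuclideanSpace ℝ (Fin p))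
    (L : EuclideanSpace ℝ (Fin p) → A) (τ : Q → A → Q) (F : Set Q)
    (ε δ : ℝ) (hε : 0 ≤ ε) (hδ0 : 0 ≤ δ) (hδ1 : δ ≤ 1)
    (hcov : ∀ x' : Xh, ∃ x : X, ‖h x - hh x'‖ ≤ ε)
    (That : Xh → U → Xh → ℝ)
    (hT0 : ∀ xh u xh', 0 ≤ That xh u xh')
    (hT1 : ∀ xh u, ∑ xh' : Xh, That xh u xh' = 1)
    [MeasurableSpace X] [MeasurableSpace A] [DiscreteMeasurableSpace A]
    [MeasurableSpace Xh] [DiscreteMeasurableSpace Xh]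
    [MeasurableSpace Q] [DiscreteMeasurableSpace Q]
    [MeasurableSpace U] [DiscreteMeasurableSpace U]
    (hL : Measurable fun x : X => L (h x))
    (R : Set (X × Xh)) (hRmeas : MeasurableSet R)
    (hRout : ∀ s ∈ R, ‖h s.1 - hh s.2‖ ≤ ε)
    (x0 : X) (xh0 : Xh) (hR0 : (x0, xh0) ∈ R) (q0 : Q)
    (κ : X × Xh → U → Measure (X × Xh))
    (hκprob : ∀ s u, IsProbabilityMeasure (κ s u))
    (hκmeas : ∀ u : U, Measurable fun s : X × Xh => κ s u)
    (hκ1 : ∀ s ∈ R, ∀ (u : U) (xh' : Xh),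
      κ s u (Set.univ ×ˢ ({xh'} : Set Xh)) = ENNReal.ofReal (That s.2 u xh'))
    (hκ2 : ∀ s ∈ R, ∀ (u : U) (xh' : Xh),
      ENNReal.ofReal ((1 - δ) * That s.2 u xh') ≤
        κ s u {y : X × Xh | y.2 = xh' ∧ (y.1, xh') ∈ R})
    (H : ℕ) (ρ : ℕ → Xh × Q → U) :
    Vbar h hh L τ ε (Qeps_nonempty h hh L τ ε hcov) That F δ H ρ H
        (xh0, τ q0 (L (h x0))) ≤
      (muSeq h L τ F κ ρ (x0, xh0, τ q0 (L (h x0))) H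
        {s : X × Xh × Q | s.2.2 ∈ F}).toReal := by
  have hQ := Qeps_nonempty h hh L τ ε hcov
  set V := Vbar h hh L τ ε (Qeps_nonempty h hh L τ ε hcov) That F δ H ρ with hV
  set init : X × Xh × Q := (x0, xh0, τ q0 (L (h x0))) with hinit
  set μ := muSeq h L τ F κ ρ init with hμ
  have hμs : ∀ k, μ (k + 1) = (μ k).bind (stepK h L τ F κ (ρ k)) := fun k => rfl
  have hKm : ∀ k, Measurable (stepK h L τ F κ (ρ k)) := fun k =>
    measurable_stepK h L τ F hL κ hκmeas (ρ k)
  have hV0 : ∀ s, V 0 s = if s.2 ∈ F then 1 else 0 := fun s => rfl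
  have hVs : ∀ n s, V (n + 1) s = if s.2 ∈ F then 1
      else (1 - δ) * ∑ x' : Xh,
        ((Qeps h hh L τ ε s.2 x').inf' (Qeps_nonempty h hh L τ ε hcov s.2 x')
          fun q' => V n (x', q')) * That s.1 (ρ (H - n - 1) s) x' := fun n s => rfl
  have hVF : ∀ n s, s.2 ∈ F → V n s = 1 := by
    intro n s hs
    cases n with
    | zero => rw [hV0, if_pos hs]
    | succ n => rw [hVs, if_pos hs]
  have hVnn : ∀ n s, 0 ≤ V n s := by
    intro n
    induction n with
    | zero => intro s; rw [hV0]; split_ifs <;> norm_num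
    | succ n ih =>
      intro s
      rw [hVs]
      split_ifs
      · norm_num
      · refine mul_nonneg (by linarith) (Finset.sum_nonneg fun x' _ => mul_nonneg ?_ (hT0 _ _ _))
        exact Finset.le_inf' _ _ fun q' _ => ih _
  have hKprob : ∀ k s, stepK h L τ F κ (ρ k) s Set.univ = 1 := by
    intro k s
    unfold stepK
    split_ifs
    · simp
    · rw [Measure.map_apply (measurable_next h L τ hL _) MeasurableSet.univ]
      simp
  have hμprob : ∀ k, μ k Set.univ = 1 := by
    intro k
    induction k with
    | zero => change Measure.dirac init Set.univ = 1; simp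
    | succ k ih =>
      rw [hμs, Measure.bind_apply MeasurableSet.univ (hKm k).aemeasurable]
      simp [hKprob, ih]
  let W : ℕ → X × Xh × Q → ENNReal := fun n s =>
    if s.2.2 ∈ F ∨ (s.1, s.2.1) ∈ R then ENNReal.ofReal (V n s.2) else 0
  have hWm : ∀ n, Measurable (W n) := by
    intro n
    have hF : MeasurableSet {s : X × Xh × Q | s.2.2 ∈ F} :=
      (measurable_snd.comp measurable_snd) (MeasurableSet.of_discrete (s := F))
    have hR : MeasurableSet {s : X × Xh × Q | (s.1, s.2.1) ∈ R} :=
      (measurable_fst.prodMk (measurable_fst.comp measurable_snd)) hRmeas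
    refine Measurable.ite (hF.union hR) ?_ measurable_const
    exact (Measurable.of_discrete (f := fun t : Xh × Q => ENNReal.ofReal (V n t))).comp
      measurable_snd
  have hstep : ∀ n k, H - n - 1 = k → ∀ s,
      W (n + 1) s ≤ ∫⁻ t, W n t ∂(stepK h L τ F κ (ρ k) s) := by
    rintro n k rfl ⟨x, xh, q⟩
    by_cases hq : q ∈ F
    · simp only [stepK, hq, if_true]
      rw [lintegral_dirac' _ (hWm n)]
      simp [W, hq, hVF]
    by_cases hR : (x, xh) ∈ R
    swap
    · simp [W, hq, hR]
    simp only [stepK, hq, if_false]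
    rw [lintegral_map (hWm n) (measurable_next h L τ hL q)]
    set u := ρ (H - n - 1) (xh, q) with hu
    let m : Xh → ℝ := fun x' =>
      (Qeps h hh L τ ε q x').inf' (Qeps_nonempty h hh L τ ε hcov q x') fun q' => V n (x', q')
    have hm : ∀ x', 0 ≤ m x' := fun x' => Finset.le_inf' _ _ fun q' _ => hVnn _ _
    let S : Xh → Set (X × Xh) := fun x' => {y | y.2 = x' ∧ (y.1, x') ∈ R}
    have hS : ∀ x', MeasurableSet (S x') := by
      intro x'
      have h1 : MeasurableSet {y : X × Xh | y.2 = x'} :=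
        measurable_snd (MeasurableSet.of_discrete (s := ({x'} : Set Xh)))
      have h2 : MeasurableSet {y : X × Xh | (y.1, x') ∈ R} :=
        (measurable_fst.prodMk measurable_const) hRmeas
      exact h1.inter h2
    calc W (n + 1) (x, xh, q)
        = ENNReal.ofReal (∑ x' : Xh, m x' * ((1 - δ) * That xh u x')) := by
          simp only [W, hR, or_true, if_true]
          rw [hVs, if_neg hq, Finset.mul_sum]
          congr 1
          refine Finset.sum_congr rfl fun x' _ => ?_
          simp only [m, hu]
          ring
      _ = ∑ x' : Xh, ENNReal.ofReal (m x') * ENNReal.ofReal ((1 - δ) * That xh u x') := by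
          rw [ENNReal.ofReal_sum_of_nonneg]
          · exact Finset.sum_congr rfl fun x' _ => ENNReal.ofReal_mul (hm x')
          · exact fun x' _ => mul_nonneg (hm x') (mul_nonneg (by linarith) (hT0 _ _ _))
      _ ≤ ∑ x' : Xh, ENNReal.ofReal (m x') * κ (x, xh) u (S x') := by
          refine Finset.sum_le_sum fun x' _ => ?_
          gcongr
          exact hκ2 (x, xh) hR u x'
      _ = ∫⁻ y, ∑ x' : Xh, (S x').indicator (fun _ => ENNReal.ofReal (m x')) y
            ∂(κ (x, xh) u) := by
          rw [lintegral_finsetSum _ fun x' _ => measurable_const.indicator (hS x')]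
          refine Finset.sum_congr rfl fun x' _ => ?_
          rw [lintegral_indicator_const (hS x')]
      _ ≤ _ := by
          refine lintegral_mono fun y => ?_
          rw [Finset.sum_eq_single y.2]
          · by_cases hy : y ∈ R
            · have hy' : y ∈ S y.2 := ⟨rfl, hy⟩
              rw [Set.indicator_of_mem hy']
              have hy2 : (y.1, y.2) ∈ R := hy
              simp only [W, hy2, or_true, if_true]
              refine ENNReal.ofReal_le_ofReal ?_
              exact Finset.inf'_le (f := fun q' => V n (y.2, q'))
                (Finset.mem_filter.2 ⟨Finset.mem_univ _, y.1, rfl, hRout y hy⟩)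
            · have hy' : y ∉ S y.2 := fun hc => hy hc.2
              rw [Set.indicator_of_notMem hy']
              exact zero_le
          · intro b _ hb
            exact Set.indicator_of_notMem (fun hc => hb hc.1.symm) _
          · intro hc; exact absurd (Finset.mem_univ _) hc
  have hmono : ∀ k, k ≤ H → W H init ≤ ∫⁻ s, W (H - k) s ∂(μ k) := by
    intro k
    induction k with
    | zero =>
      intro _
      change W H init ≤ ∫⁻ s, W H s ∂(Measure.dirac init)
      rw [lintegral_dirac' _ (hWm H)]
    | succ k ih =>
      intro hk
      refine (ih (by omega)).trans ?_
      rw [hμs, Measure.lintegral_bind (hKm k).aemeasurable (hWm _).aemeasurable]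
      refine lintegral_mono fun s => ?_
      have e : H - k = (H - (k + 1)) + 1 := by omega
      rw [e]
      exact hstep _ k (by omega) s
  have hfin := hmono H le_rfl
  have hF : MeasurableSet {s : X × Xh × Q | s.2.2 ∈ F} :=
    (measurable_snd.comp measurable_snd) (MeasurableSet.of_discrete (s := F))
  have hW0 : ∫⁻ s, W (H - H) s ∂(μ H) ≤ μ H {s : X × Xh × Q | s.2.2 ∈ F} := by
    rw [← lintegral_indicator_one hF, Nat.sub_self]
    refine lintegral_mono fun s => ?_
    by_cases hs : s.2.2 ∈ F
    · simp [W, hs, hV0]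
    · simp [W, hs, hV0]
  have hWi : W H init = ENNReal.ofReal (V H (xh0, τ q0 (L (h x0)))) := by
    simp [W, hinit, hR0]
  rw [hWi] at hfin
  have hne : μ H {s : X × Xh × Q | s.2.2 ∈ F} ≠ ⊤ :=
    ne_top_of_le_ne_top (by rw [hμprob H]; exact ENNReal.one_ne_top)
      (measure_mono (Set.subset_univ _))
  exact (ENNReal.ofReal_le_iff_le_toReal hne).1 (hfin.trans hW0)

end
end

section
/- Under the stated finite-abstraction and kernel hypotheses (in particular the (ε,δ)-approximate probabilistic relation encoded by conditions (i) and (ii) on κ), for every Markov policy ρ over horizon H one has μ_H({(x, x̂, q) | q ∈ F}) ≤ V̲^ρ_H(x̂₀, q̄₀). Since the q-component is frozen once it enters F, the left-hand side equals the probability that the controlled original system reaches an accepting DFA state within H steps (Theorem 2 of the paper). -/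
set_option autoImplicit false

open Finset MeasureTheory

attribute [local instance] Classical.propDecidable

noncomputable section

variable {p : ℕ} {X Xh A Q U : Type*}

lemma aux_V01 [Fintype Q] [Fintype Xh]
    (h : X → EuclideanSpace ℝ (Fin p)) (hh : Xh → EuclideanSpace ℝ (Fin p))
    (L : EuclideanSpace ℝ (Fin p) → A) (τ : Q → A → Q) (ε : ℝ)
    (hQ : ∀ (q : Q) (x' : Xh), (Qeps h hh L τ ε q x').Nonempty)
    (That : Xh → U → Xh → ℝ) (F : Set Q) (δ : ℝ) (H : ℕ) (ρ : ℕ → Xh × Q → U)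
    (hδ0 : 0 ≤ δ) (hδ1 : δ ≤ 1)
    (hT0 : ∀ xh u xh', 0 ≤ That xh u xh')
    (hT1 : ∀ xh u, ∑ xh' : Xh, That xh u xh' = 1) (n : ℕ) :
    ∀ s, 0 ≤ Vunder h hh L τ ε hQ That F δ H ρ n s ∧
      Vunder h hh L τ ε hQ That F δ H ρ n s ≤ 1 := by
  induction n with
  | zero => intro s; rw [Vunder]; split_ifs <;> norm_num
  | succ n ih =>
    intro s
    rw [Vunder]
    split_ifs
    · norm_num
    · have h1 : 0 ≤ ∑ x' : Xh, ((Qeps h hh L τ ε s.2 x').sup' (hQ s.2 x')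
          fun q' => Vunder h hh L τ ε hQ That F δ H ρ n (x', q'))
          * That s.1 (ρ (H - n - 1) s) x' := by
        refine Finset.sum_nonneg fun x' _ => mul_nonneg ?_ (hT0 _ _ _)
        obtain ⟨q', hq'⟩ := hQ s.2 x'
        exact (ih (x', q')).1.trans (Finset.le_sup' (fun q' => Vunder h hh L τ ε hQ That F δ H ρ n (x', q')) hq')
      have h2 : ∑ x' : Xh, ((Qeps h hh L τ ε s.2 x').sup' (hQ s.2 x')
          fun q' => Vunder h hh L τ ε hQ That F δ H ρ n (x', q'))
          * That s.1 (ρ (H - n - 1) s) x' ≤ 1 := by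
        rw [← hT1 s.1 (ρ (H - n - 1) s)]
        refine Finset.sum_le_sum fun x' _ => mul_le_of_le_one_left (hT0 _ _ _) ?_
        exact Finset.sup'_le _ _ fun q' _ => (ih (x', q')).2
      constructor
      · have := mul_nonneg (sub_nonneg.2 hδ1) h1
        linarith
      · nlinarith

/-- One-step estimate. -/
lemma aux_step {Z : Type*} [MeasurableSpace Z] [Fintype Xh] (ν : Measure Z) [IsProbabilityMeasure ν]
    (B : Xh → Set Z) (hB : ∀ x, MeasurableSet (B x)) (m T : Xh → ℝ) (δ : ℝ)
    (hm1 : ∀ x, m x ≤ 1) (hδ1 : δ ≤ 1)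
    (hT0 : ∀ x, 0 ≤ T x) (hT1 : ∑ x, T x = 1)
    (hν : ∀ x, ENNReal.ofReal ((1 - δ) * T x) ≤ ν (B x))
    (G : Z → ENNReal)
    (hG : ∀ z, G z + ∑ x, (B x).indicator (fun _ => ENNReal.ofReal (1 - m x)) z ≤ 1) :
    ∫⁻ z, G z ∂ν ≤ ENNReal.ofReal ((1 - δ) * (∑ x, m x * T x) + δ) := by
  have hS : 0 ≤ ∑ x, (1 - m x) * ((1 - δ) * T x) := Finset.sum_nonneg fun x _ =>
    mul_nonneg (sub_nonneg.2 (hm1 x)) (mul_nonneg (sub_nonneg.2 hδ1) (hT0 x))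
  have e : (1 - δ) * (∑ x, m x * T x) + δ = 1 - ∑ x, (1 - m x) * ((1 - δ) * T x) := by
    have : ∑ x, (1 - m x) * ((1 - δ) * T x) = (1 - δ) * (∑ x, T x) - (1 - δ) * ∑ x, m x * T x := by
      rw [Finset.mul_sum, Finset.mul_sum, ← Finset.sum_sub_distrib]
      exact Finset.sum_congr rfl fun x _ => by ring
    rw [this, hT1]; ring
  rw [e, ENNReal.ofReal_sub _ hS, ENNReal.ofReal_one]
  refine ENNReal.le_sub_of_add_le_right ENNReal.ofReal_ne_top ?_
  have hmeas : Measurable fun z => ∑ x, (B x).indicator (fun _ => ENNReal.ofReal (1 - m x)) z :=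
    Finset.measurable_fun_sum _ fun x _ => measurable_const.indicator (hB x)
  calc ∫⁻ z, G z ∂ν + ENNReal.ofReal (∑ x, (1 - m x) * ((1 - δ) * T x))
      ≤ ∫⁻ z, G z ∂ν + ∫⁻ z, ∑ x, (B x).indicator (fun _ => ENNReal.ofReal (1 - m x)) z ∂ν := by
        gcongr
        rw [lintegral_finsetSum _ fun x _ => measurable_const.indicator (hB x),
          ENNReal.ofReal_sum_of_nonneg fun x _ =>
            mul_nonneg (sub_nonneg.2 (hm1 x)) (mul_nonneg (sub_nonneg.2 hδ1) (hT0 x))]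
        refine Finset.sum_le_sum fun x _ => ?_
        rw [lintegral_indicator_const (hB x), ENNReal.ofReal_mul (sub_nonneg.2 (hm1 x))]
        gcongr
        exact hν x
    _ = ∫⁻ z, (G z + ∑ x, (B x).indicator (fun _ => ENNReal.ofReal (1 - m x)) z) ∂ν :=
        (lintegral_add_right _ hmeas).symm
    _ ≤ ∫⁻ _, 1 ∂ν := lintegral_mono hG
    _ = 1 := by simp

set_option maxHeartbeats 1600000 in
theorem statement1
    (hp : 1 ≤ p) [Nonempty X] [Fintype Xh] [Nonempty Xh] [Fintype A] [Fintype Q]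
    [Fintype U] [Nonempty U]
    (h : X → EuclideanSpace ℝ (Fin p)) (hh : Xh → EuclideanSpace ℝ (Fin p))
    (L : EuclideanSpace ℝ (Fin p) → A) (τ : Q → A → Q) (F : Set Q)
    (ε δ : ℝ) (hε : 0 ≤ ε) (hδ0 : 0 ≤ δ) (hδ1 : δ ≤ 1)
    (hcov : ∀ x' : Xh, ∃ x : X, ‖h x - hh x'‖ ≤ ε)
    (That : Xh → U → Xh → ℝ)
    (hT0 : ∀ xh u xh', 0 ≤ That xh u xh')
    (hT1 : ∀ xh u, ∑ xh' : Xh, That xh u xh' = 1)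
    [MeasurableSpace X] [MeasurableSpace A] [DiscreteMeasurableSpace A]
    [MeasurableSpace Xh] [DiscreteMeasurableSpace Xh]
    [MeasurableSpace Q] [DiscreteMeasurableSpace Q]
    [MeasurableSpace U] [DiscreteMeasurableSpace U]
    (hL : Measurable fun x : X => L (h x))
    (R : Set (X × Xh)) (hRmeas : MeasurableSet R)
    (hRout : ∀ s ∈ R, ‖h s.1 - hh s.2‖ ≤ ε)
    (x0 : X) (xh0 : Xh) (hR0 : (x0, xh0) ∈ R) (q0 : Q)
    (κ : X × Xh → U → Measure (X × Xh))
    (hκprob : ∀ s u, IsProbabilityMeasure (κ s u))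
    (hκmeas : ∀ u : U, Measurable fun s : X × Xh => κ s u)
    (hκ1 : ∀ s ∈ R, ∀ (u : U) (xh' : Xh),
      κ s u (Set.univ ×ˢ ({xh'} : Set Xh)) = ENNReal.ofReal (That s.2 u xh'))
    (hκ2 : ∀ s ∈ R, ∀ (u : U) (xh' : Xh),
      ENNReal.ofReal ((1 - δ) * That s.2 u xh') ≤
        κ s u {y : X × Xh | y.2 = xh' ∧ (y.1, xh') ∈ R})
    (H : ℕ) (ρ : ℕ → Xh × Q → U) :
    (muSeq h L τ F κ ρ (x0, xh0, τ q0 (L (h x0))) H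
        {s : X × Xh × Q | s.2.2 ∈ F}).toReal ≤
      Vunder h hh L τ ε (Qeps_nonempty h hh L τ ε hcov) That F δ H ρ H
        (xh0, τ q0 (L (h x0))) := by
  classical
  set V := Vunder h hh L τ ε (Qeps_nonempty h hh L τ ε hcov) That F δ H ρ with hV
  have hV01 : ∀ n s, 0 ≤ V n s ∧ V n s ≤ 1 := fun n =>
    aux_V01 h hh L τ ε _ That F δ H ρ hδ0 hδ1 hT0 hT1 n
  have hVF : ∀ n (s : Xh × Q), s.2 ∈ F → V n s = 1 := by
    intro n s hs
    cases n <;> rw [hV, Vunder, if_pos hs]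
  set G : ℕ → X × Xh × Q → ENNReal := fun n s =>
    if (s.1, s.2.1) ∈ R then ENNReal.ofReal (V n s.2) else 1 with hG
  have hGF : ∀ n s, s.2.2 ∈ F → G n s = 1 := by
    intro n s hs
    simp [hG, hVF n s.2 hs]
  have hG1 : ∀ n s, G n s ≤ 1 := by
    intro n s
    simp only [hG]
    split_ifs
    · exact ENNReal.ofReal_le_one.2 (hV01 n _).2
    · exact le_rfl
  have hGm : ∀ n, Measurable (G n) := by
    intro n
    refine Measurable.ite ?_ ?_ measurable_const
    · exact (measurable_fst.prodMk (measurable_fst.comp measurable_snd)) hRmeas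
    · exact (Measurable.of_discrete (f := fun t => ENNReal.ofReal (V n t))).comp measurable_snd
  set K : ℕ → X × Xh × Q → Measure (X × Xh × Q) := fun k s =>
    if s.2.2 ∈ F then Measure.dirac s
      else (κ (s.1, s.2.1) (ρ k (s.2.1, s.2.2))).map
        fun y : X × Xh => (y.1, y.2, τ s.2.2 (L (h y.1))) with hK
  have hfm : ∀ q : Q, Measurable fun y : X × Xh => (y.1, y.2, τ q (L (h y.1))) := by
    intro q
    refine measurable_fst.prodMk (measurable_snd.prodMk ?_)
    exact (Measurable.of_discrete (f := τ q)).comp (hL.comp measurable_fst)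
  have hKm : ∀ k, Measurable (K k) := by
    intro k
    refine measurable_from_prod_countable_left fun t => ?_
    by_cases ht : t.2 ∈ F
    · simp only [hK, ht, if_true]
      exact Measure.measurable_dirac.comp measurable_prodMk_right
    · simp only [hK, ht, if_false]
      exact (Measure.measurable_map _ (hfm t.2)).comp
        ((hκmeas _).comp measurable_prodMk_right)
  have key : ∀ n k s, H - n - 1 = k → ∫⁻ z, G n z ∂(K k s) ≤ G (n + 1) s := by
    rintro n k ⟨x, xh, q⟩ hk
    by_cases hq : q ∈ F
    · rw [hGF (n + 1) _ hq]
      simp only [hK, hq, if_true]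
      rw [lintegral_dirac' _ (hGm n)]
      exact hG1 _ _
    · simp only [hK, hq, if_false]
      rw [lintegral_map (hGm n) (hfm q)]
      have := hκprob (x, xh) (ρ k (xh, q))
      by_cases hR : (x, xh) ∈ R
      · have hr : G (n + 1) (x, xh, q) = ENNReal.ofReal (V (n + 1) (xh, q)) := by
          simp only [hG, hR, if_true]
        rw [hr, hV, Vunder, if_neg hq, hk]
        refine aux_step _ (fun xh' => {y : X × Xh | y.2 = xh' ∧ (y.1, xh') ∈ R}) ?_ _ _ δ
          ?_ hδ1 (hT0 _ _) (hT1 _ _) (hκ2 (x, xh) hR _) _ ?_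
        · intro xh'
          have e : {y : X × Xh | y.2 = xh' ∧ (y.1, xh') ∈ R} =
              Prod.snd ⁻¹' {xh'} ∩ R := by
            ext ⟨a, b⟩
            simp only [Set.mem_ofPred_eq, Set.mem_inter_iff, Set.mem_preimage,
              Set.mem_singleton_iff]
            constructor
            · rintro ⟨rfl, h2⟩; exact ⟨rfl, h2⟩
            · rintro ⟨rfl, h2⟩; exact ⟨rfl, h2⟩
          rw [e]
          exact (measurable_snd (MeasurableSet.of_discrete)).inter hRmeas
        · intro xh'
          exact Finset.sup'_le _ _ fun q' _ => (hV01 n (xh', q')).2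
        · rintro ⟨y, yh⟩
          by_cases hy : (y, yh) ∈ R
          · rw [Finset.sum_eq_single yh]
            · have hmem : τ q (L (h y)) ∈ Qeps h hh L τ ε q yh := by
                have hyy : ‖h y - hh yh‖ ≤ ε := hRout (y, yh) hy
                rw [Qeps, Finset.mem_filter]
                exact ⟨Finset.mem_univ _, y, rfl, hyy⟩
              have hle := Finset.le_sup' (fun q' => V n (yh, q')) hmem
              have hup : (Qeps h hh L τ ε q yh).sup' ⟨_, hmem⟩ (fun q' => V n (yh, q')) ≤ 1 :=
                Finset.sup'_le _ _ fun q' _ => (hV01 n (yh, q')).2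
              rw [Set.indicator_of_mem (by exact ⟨rfl, hy⟩)]
              simp only [hG, hy, if_true]
              rw [← ENNReal.ofReal_add (hV01 _ _).1 (sub_nonneg.2 hup)]
              refine ENNReal.ofReal_le_one.2 ?_
              linarith
            · intro b _ hb
              exact Set.indicator_of_notMem (fun hc => hb hc.1.symm) _
            · intro hc; exact absurd (Finset.mem_univ _) hc
          · rw [Finset.sum_eq_zero]
            · rw [add_zero]; exact hG1 _ _
            · intro b _
              refine Set.indicator_of_notMem ?_ _
              rintro ⟨rfl, hc⟩
              exact hy hc
      · have hr : G (n + 1) (x, xh, q) = 1 := by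
          simp only [hG, hR, if_false]
        rw [hr]
        refine (lintegral_mono fun y => hG1 _ _).trans ?_
        simp
  have hmu : ∀ k, k ≤ H → ∫⁻ z, G (H - k) z ∂(muSeq h L τ F κ ρ (x0, xh0, τ q0 (L (h x0))) k)
      ≤ ENNReal.ofReal (V H (xh0, τ q0 (L (h x0)))) := by
    intro k
    induction k with
    | zero =>
      intro _
      rw [muSeq, lintegral_dirac' _ (hGm _)]
      simp [hG, hR0]
    | succ k ih =>
      intro hk
      refine le_trans ?_ (ih (by omega))
      rw [muSeq]
      change ∫⁻ z, G (H - (k + 1)) z ∂(Measure.bind _ (K k)) ≤ _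
      rw [Measure.lintegral_bind (hKm k).aemeasurable (hGm _).aemeasurable]
      refine lintegral_mono fun s => ?_
      have e : H - k = (H - (k + 1)) + 1 := by omega
      rw [e]
      exact key _ _ _ (by omega)
  refine ENNReal.toReal_le_of_le_ofReal (hV01 _ _).1 ((le_trans ?_ (hmu H le_rfl)))
  have hFm : MeasurableSet {s : X × Xh × Q | s.2.2 ∈ F} :=
    (measurable_snd.comp measurable_snd) (MeasurableSet.of_discrete (s := F))
  rw [← lintegral_indicator_one hFm]
  refine lintegral_mono fun s => ?_
  by_cases hs : s.2.2 ∈ F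
  · rw [hGF _ _ hs]
    exact Set.indicator_le_self' (by simp) s
  · rw [Set.indicator_of_notMem (by exact hs)]
    exact zero_le

end
end

section
/- For every Markov policy ρ over horizon H, every 0 ≤ n ≤ H, every x̂ ∈ X̂ and every q ∈ Q, one has V̄^ρ_n(x̂,q) ≤ V̄*_n(x̂,q). In particular, V̄*_H(x̂,q) is an upper bound for V̄^ρ_H(x̂,q) over all Markov policies ρ (first part of Proposition 1 of the paper). -/
set_option autoImplicit false

open Finset MeasureTheory

attribute [local instance] Classical.propDecidable

noncomputable section

variable {p : ℕ} {X Xh A Q U : Type*}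

/-- Optimal robust cost-to-go functions `V̄*_n`. -/
def Vstar [Fintype Q] [Fintype Xh] [Fintype U] [Nonempty U]
    (h : X → EuclideanSpace ℝ (Fin p)) (hh : Xh → EuclideanSpace ℝ (Fin p))
    (L : EuclideanSpace ℝ (Fin p) → A) (τ : Q → A → Q) (ε : ℝ)
    (hQ : ∀ (q : Q) (x' : Xh), (Qeps h hh L τ ε q x').Nonempty)
    (That : Xh → U → Xh → ℝ) (F : Set Q) (δ : ℝ) :
    ℕ → Xh × Q → ℝ
  | 0, s => if s.2 ∈ F then 1 else 0
  | n + 1, s =>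
      if s.2 ∈ F then 1
      else (Finset.univ : Finset U).sup' Finset.univ_nonempty fun u =>
        (1 - δ) * ∑ x' : Xh,
          ((Qeps h hh L τ ε s.2 x').inf' (hQ s.2 x')
            fun q' => Vstar h hh L τ ε hQ That F δ n (x', q'))
          * That s.1 u x'

theorem statement2
    (hp : 1 ≤ p) [Nonempty X] [Fintype Xh] [Nonempty Xh] [Fintype A] [Fintype Q]
    [Fintype U] [Nonempty U]
    (h : X → EuclideanSpace ℝ (Fin p)) (hh : Xh → EuclideanSpace ℝ (Fin p))
    (L : EuclideanSpace ℝ (Fin p) → A) (τ : Q → A → Q) (F : Set Q)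
    (ε δ : ℝ) (hε : 0 ≤ ε) (hδ0 : 0 ≤ δ) (hδ1 : δ ≤ 1)
    (hcov : ∀ x' : Xh, ∃ x : X, ‖h x - hh x'‖ ≤ ε)
    (That : Xh → U → Xh → ℝ)
    (hT0 : ∀ xh u xh', 0 ≤ That xh u xh')
    (hT1 : ∀ xh u, ∑ xh' : Xh, That xh u xh' = 1)
    (H : ℕ) (ρ : ℕ → Xh × Q → U) (n : ℕ) (hn : n ≤ H) (xh : Xh) (q : Q) :
    Vbar h hh L τ ε (Qeps_nonempty h hh L τ ε hcov) That F δ H ρ n (xh, q) ≤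
      Vstar h hh L τ ε (Qeps_nonempty h hh L τ ε hcov) That F δ n (xh, q) := by
  induction n generalizing xh q with
  | zero => simp only [Vbar, Vstar]; exact le_refl _
  | succ n ih =>
    simp only [Vbar, Vstar]
    split_ifs with hq
    · exact le_refl _
    · refine le_trans ?_ (Finset.le_sup' _ (Finset.mem_univ (ρ (H - n - 1) (xh, q))))
      refine mul_le_mul_of_nonneg_left ?_ (by linarith)
      refine Finset.sum_le_sum fun x' _ => ?_
      refine mul_le_mul_of_nonneg_right ?_ (hT0 _ _ _)
      refine Finset.le_inf' _ _ fun q' hq' => ?_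
      exact le_trans (Finset.inf'_le _ hq') (ih (by omega) x' q')

end
end

section
/- There exists a Markov policy ρ* over horizon H such that for every 0 ≤ n < H, x̂ ∈ X̂ and q ∈ Q, the input ρ*_{H−n−1}(x̂,q) maximizes û ↦ (1−δ) · ∑_{x̂' ∈ X̂} (min_{q' ∈ Q'_ε(q,x̂')} V̄*_n(x̂',q')) · T̂ x̂ û x̂' over Û; and every such greedy policy satisfies V̄^{ρ*}_n(x̂,q) = V̄*_n(x̂,q) for all 0 ≤ n ≤ H, x̂ ∈ X̂ and q ∈ Q. Hence ρ* attains the maximum of V̄^ρ_H(x̂,q) over all Markov policies ρ (Proposition 1 of the paper). -/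
set_option autoImplicit false

open Finset MeasureTheory

attribute [local instance] Classical.propDecidable

noncomputable section

variable {p : ℕ} {X Xh A Q U : Type*}

/-- The greedy one-step value `û ↦ (1−δ)·∑_{x̂'} (min_{q'∈Q'_ε(q,x̂')} V̄*_n(x̂',q'))·T̂ x̂ û x̂'`. -/
def greedyVal [Fintype Q] [Fintype Xh] [Fintype U] [Nonempty U]
    (h : X → EuclideanSpace ℝ (Fin p)) (hh : Xh → EuclideanSpace ℝ (Fin p))
    (L : EuclideanSpace ℝ (Fin p) → A) (τ : Q → A → Q) (ε : ℝ)
    (hQ : ∀ (q : Q) (x' : Xh), (Qeps h hh L τ ε q x').Nonempty)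
    (That : Xh → U → Xh → ℝ) (F : Set Q) (δ : ℝ)
    (n : ℕ) (xh : Xh) (q : Q) (u : U) : ℝ :=
  (1 - δ) * ∑ x' : Xh,
    ((Qeps h hh L τ ε q x').inf' (hQ q x')
      fun q' => Vstar h hh L τ ε hQ That F δ n (x', q'))
    * That xh u x'

theorem statement3
    (hp : 1 ≤ p) [Nonempty X] [Fintype Xh] [Nonempty Xh] [Fintype A] [Fintype Q]
    [Fintype U] [Nonempty U]
    (h : X → EuclideanSpace ℝ (Fin p)) (hh : Xh → EuclideanSpace ℝ (Fin p))
    (L : EuclideanSpace ℝ (Fin p) → A) (τ : Q → A → Q) (F : Set Q)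
    (ε δ : ℝ) (hε : 0 ≤ ε) (hδ0 : 0 ≤ δ) (hδ1 : δ ≤ 1)
    (hcov : ∀ x' : Xh, ∃ x : X, ‖h x - hh x'‖ ≤ ε)
    (That : Xh → U → Xh → ℝ)
    (hT0 : ∀ xh u xh', 0 ≤ That xh u xh')
    (hT1 : ∀ xh u, ∑ xh' : Xh, That xh u xh' = 1)
    (H : ℕ) :
    (∃ ρ : ℕ → Xh × Q → U, ∀ n < H, ∀ (xh : Xh) (q : Q) (u : U),
        greedyVal h hh L τ ε (Qeps_nonempty h hh L τ ε hcov) That F δ n xh q u ≤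
          greedyVal h hh L τ ε (Qeps_nonempty h hh L τ ε hcov) That F δ n xh q
            (ρ (H - n - 1) (xh, q))) ∧
    (∀ ρ : ℕ → Xh × Q → U,
        (∀ n < H, ∀ (xh : Xh) (q : Q) (u : U),
          greedyVal h hh L τ ε (Qeps_nonempty h hh L τ ε hcov) That F δ n xh q u ≤
            greedyVal h hh L τ ε (Qeps_nonempty h hh L τ ε hcov) That F δ n xh q
              (ρ (H - n - 1) (xh, q))) →
        (∀ n ≤ H, ∀ (xh : Xh) (q : Q),
          Vbar h hh L τ ε (Qeps_nonempty h hh L τ ε hcov) That F δ H ρ n (xh, q) =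
            Vstar h hh L τ ε (Qeps_nonempty h hh L τ ε hcov) That F δ n (xh, q)) ∧
        (∀ (ρ' : ℕ → Xh × Q → U) (xh : Xh) (q : Q),
          Vbar h hh L τ ε (Qeps_nonempty h hh L τ ε hcov) That F δ H ρ' H (xh, q) ≤
            Vbar h hh L τ ε (Qeps_nonempty h hh L τ ε hcov) That F δ H ρ H (xh, q))) := by
  have hmono : ∀ (ρ' : ℕ → Xh × Q → U) (n : ℕ) (s : Xh × Q),
      Vbar h hh L τ ε (Qeps_nonempty h hh L τ ε hcov) That F δ H ρ' n s ≤
        Vstar h hh L τ ε (Qeps_nonempty h hh L τ ε hcov) That F δ n s := by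
    intro ρ' n
    induction n with
    | zero => intro s; simp only [Vbar, Vstar]; exact le_rfl
    | succ n ih =>
      intro s
      simp only [Vbar, Vstar]
      by_cases hs : s.2 ∈ F
      · rw [if_pos hs, if_pos hs]
      · rw [if_neg hs, if_neg hs]
        refine le_trans ?_ (Finset.le_sup' _ (Finset.mem_univ (ρ' (H - n - 1) s)))
        refine mul_le_mul_of_nonneg_left ?_ (by linarith)
        refine Finset.sum_le_sum fun x' _ => ?_
        refine mul_le_mul_of_nonneg_right ?_ (hT0 _ _ _)
        refine Finset.le_inf' _ _ fun q' hq' => ?_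
        exact (Finset.inf'_le _ hq').trans (ih (x', q'))
  refine ⟨?_, ?_⟩
  · have hex : ∀ (n : ℕ) (s : Xh × Q), ∃ v : U, ∀ u : U,
        greedyVal h hh L τ ε (Qeps_nonempty h hh L τ ε hcov) That F δ n s.1 s.2 u ≤
          greedyVal h hh L τ ε (Qeps_nonempty h hh L τ ε hcov) That F δ n s.1 s.2 v :=
      fun n s => Finite.exists_max _
    choose g hg using hex
    refine ⟨fun k s => g (H - k - 1) s, fun n hn xh q u => ?_⟩
    have e : H - (H - n - 1) - 1 = n := by omega
    simp only [e]
    exact hg n (xh, q) u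
  · intro ρ hρ
    have heq : ∀ n ≤ H, ∀ (xh : Xh) (q : Q),
        Vbar h hh L τ ε (Qeps_nonempty h hh L τ ε hcov) That F δ H ρ n (xh, q) =
          Vstar h hh L τ ε (Qeps_nonempty h hh L τ ε hcov) That F δ n (xh, q) := by
      intro n
      induction n with
      | zero => intro _ xh q; simp only [Vbar, Vstar]
      | succ n ih =>
        intro hn xh q
        have ih' := ih (by omega)
        simp only [Vbar, Vstar]
        by_cases hs : q ∈ F
        · rw [if_pos hs, if_pos hs]
        · rw [if_neg hs, if_neg hs]
          simp only [ih']
          apply le_antisymm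
          · exact Finset.le_sup' (fun u => greedyVal h hh L τ ε
              (Qeps_nonempty h hh L τ ε hcov) That F δ n xh q u)
              (Finset.mem_univ (ρ (H - n - 1) (xh, q)))
          · exact Finset.sup'_le _ _ fun u _ => hρ n (by omega) xh q u
    refine ⟨heq, fun ρ' xh q => ?_⟩
    rw [heq H le_rfl]
    exact hmono ρ' H (xh, q)

end
end

section
/- There exists a Markov policy ρ* over horizon H such that for every 0 ≤ n < H, x̂ ∈ X̂ and q ∈ Q, the input ρ*_{H−n−1}(x̂,q) minimizes û ↦ (1−δ) · ∑_{x̂' ∈ X̂} (max_{q' ∈ Q'_ε(q,x̂')} V̲*_n(x̂',q')) · T̂ x̂ û x̂' + δ over Û; and every such greedy policy satisfies V̲^{ρ*}_n(x̂,q) = V̲*_n(x̂,q) for all 0 ≤ n ≤ H, x̂ ∈ X̂ and q ∈ Q. Hence ρ* attains the minimum of V̲^ρ_H(x̂,q) over all Markov policies ρ (Proposition 2 of the paper). -/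
set_option autoImplicit false

open Finset MeasureTheory

attribute [local instance] Classical.propDecidable

noncomputable section

variable {p : ℕ} {X Xh A Q U : Type*}

/-- Optimal violation cost-to-go functions `V̲*_n`. -/
def Vustar [Fintype Q] [Fintype Xh] [Fintype U] [Nonempty U]
    (h : X → EuclideanSpace ℝ (Fin p)) (hh : Xh → EuclideanSpace ℝ (Fin p))
    (L : EuclideanSpace ℝ (Fin p) → A) (τ : Q → A → Q) (ε : ℝ)
    (hQ : ∀ (q : Q) (x' : Xh), (Qeps h hh L τ ε q x').Nonempty)
    (That : Xh → U → Xh → ℝ) (F : Set Q) (δ : ℝ) :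
    ℕ → Xh × Q → ℝ
  | 0, s => if s.2 ∈ F then 1 else 0
  | n + 1, s =>
      if s.2 ∈ F then 1
      else (Finset.univ : Finset U).inf' Finset.univ_nonempty fun u =>
        (1 - δ) * (∑ x' : Xh,
          ((Qeps h hh L τ ε s.2 x').sup' (hQ s.2 x')
            fun q' => Vustar h hh L τ ε hQ That F δ n (x', q'))
          * That s.1 u x') + δ

/-- The greedy one-step value `û ↦ (1−δ)·∑_{x̂'} (max_{q'∈Q'_ε(q,x̂')} V̲*_n(x̂',q'))·T̂ x̂ û x̂' + δ`. -/
def greedyValV [Fintype Q] [Fintype Xh] [Fintype U] [Nonempty U]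
    (h : X → EuclideanSpace ℝ (Fin p)) (hh : Xh → EuclideanSpace ℝ (Fin p))
    (L : EuclideanSpace ℝ (Fin p) → A) (τ : Q → A → Q) (ε : ℝ)
    (hQ : ∀ (q : Q) (x' : Xh), (Qeps h hh L τ ε q x').Nonempty)
    (That : Xh → U → Xh → ℝ) (F : Set Q) (δ : ℝ)
    (n : ℕ) (xh : Xh) (q : Q) (u : U) : ℝ :=
  (1 - δ) * (∑ x' : Xh,
    ((Qeps h hh L τ ε q x').sup' (hQ q x')
      fun q' => Vustar h hh L τ ε hQ That F δ n (x', q'))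
    * That xh u x') + δ

theorem statement5
    (hp : 1 ≤ p) [Nonempty X] [Fintype Xh] [Nonempty Xh] [Fintype A] [Fintype Q]
    [Fintype U] [Nonempty U]
    (h : X → EuclideanSpace ℝ (Fin p)) (hh : Xh → EuclideanSpace ℝ (Fin p))
    (L : EuclideanSpace ℝ (Fin p) → A) (τ : Q → A → Q) (F : Set Q)
    (ε δ : ℝ) (hε : 0 ≤ ε) (hδ0 : 0 ≤ δ) (hδ1 : δ ≤ 1)
    (hcov : ∀ x' : Xh, ∃ x : X, ‖h x - hh x'‖ ≤ ε)
    (That : Xh → U → Xh → ℝ)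
    (hT0 : ∀ xh u xh', 0 ≤ That xh u xh')
    (hT1 : ∀ xh u, ∑ xh' : Xh, That xh u xh' = 1)
    (H : ℕ) :
    (∃ ρ : ℕ → Xh × Q → U, ∀ n < H, ∀ (xh : Xh) (q : Q) (u : U),
        greedyValV h hh L τ ε (Qeps_nonempty h hh L τ ε hcov) That F δ n xh q
            (ρ (H - n - 1) (xh, q)) ≤
          greedyValV h hh L τ ε (Qeps_nonempty h hh L τ ε hcov) That F δ n xh q u) ∧
    (∀ ρ : ℕ → Xh × Q → U,
        (∀ n < H, ∀ (xh : Xh) (q : Q) (u : U),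
          greedyValV h hh L τ ε (Qeps_nonempty h hh L τ ε hcov) That F δ n xh q
              (ρ (H - n - 1) (xh, q)) ≤
            greedyValV h hh L τ ε (Qeps_nonempty h hh L τ ε hcov) That F δ n xh q u) →
        (∀ n ≤ H, ∀ (xh : Xh) (q : Q),
          Vunder h hh L τ ε (Qeps_nonempty h hh L τ ε hcov) That F δ H ρ n (xh, q) =
            Vustar h hh L τ ε (Qeps_nonempty h hh L τ ε hcov) That F δ n (xh, q)) ∧
        (∀ (ρ' : ℕ → Xh × Q → U) (xh : Xh) (q : Q),
          Vunder h hh L τ ε (Qeps_nonempty h hh L τ ε hcov) That F δ H ρ H (xh, q) ≤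
            Vunder h hh L τ ε (Qeps_nonempty h hh L τ ε hcov) That F δ H ρ' H (xh, q))) := by
  have hlow : ∀ (ρ' : ℕ → Xh × Q → U) (n : ℕ) (xh : Xh) (q : Q),
      Vustar h hh L τ ε (Qeps_nonempty h hh L τ ε hcov) That F δ n (xh, q) ≤
        Vunder h hh L τ ε (Qeps_nonempty h hh L τ ε hcov) That F δ H ρ' n (xh, q) := by
    intro ρ' n
    induction n with
    | zero => intro xh q; simp only [Vustar, Vunder]; exact le_refl _
    | succ n ih =>
      intro xh q
      simp only [Vustar, Vunder]
      split_ifs with hF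
      · exact le_refl _
      · refine (Finset.inf'_le _ (Finset.mem_univ (ρ' (H - n - 1) (xh, q)))).trans ?_
        refine add_le_add_left (mul_le_mul_of_nonneg_left ?_ (by linarith)) δ
        refine Finset.sum_le_sum fun x' _ => mul_le_mul_of_nonneg_right ?_ (hT0 _ _ _)
        exact Finset.sup'_mono_fun fun q' _ => ih x' q'
  refine ⟨?_, ?_⟩
  · have hmin : ∀ (n : ℕ) (s : Xh × Q), ∃ u0 : U, ∀ u : U,
        greedyValV h hh L τ ε (Qeps_nonempty h hh L τ ε hcov) That F δ n s.1 s.2 u0 ≤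
          greedyValV h hh L τ ε (Qeps_nonempty h hh L τ ε hcov) That F δ n s.1 s.2 u :=
      fun n s => Finite.exists_min _
    choose g hg using hmin
    refine ⟨fun k s => g (H - k - 1) s, fun n hn xh q u => ?_⟩
    have e : H - (H - n - 1) - 1 = n := by omega
    simp only [e]
    exact hg n (xh, q) u
  · intro ρ hρ
    have heq : ∀ n ≤ H, ∀ (xh : Xh) (q : Q),
        Vunder h hh L τ ε (Qeps_nonempty h hh L τ ε hcov) That F δ H ρ n (xh, q) =
          Vustar h hh L τ ε (Qeps_nonempty h hh L τ ε hcov) That F δ n (xh, q) := by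
      intro n
      induction n with
      | zero => intro _ xh q; simp only [Vustar, Vunder]
      | succ n ih =>
        intro hn xh q
        have ih' := ih (by omega)
        simp only [Vustar, Vunder, ih']
        split_ifs with hF
        · rfl
        · apply le_antisymm
          · exact Finset.le_inf' _ _ fun u _ => hρ n (by omega) xh q u
          · exact Finset.inf'_le (fun u => greedyValV h hh L τ ε
              (Qeps_nonempty h hh L τ ε hcov) That F δ n xh q u) (Finset.mem_univ _)
    refine ⟨heq, fun ρ' xh q => ?_⟩
    rw [heq H le_rfl]
    exact hlow ρ' H xh q

end
end

section
/- Assume q̄₀ ∉ F, and let η ∈ ℝ be such that for every 0 ≤ k ≤ H−1 and every robust history path of length k for ρ one has Ē_pv(k) ≤ η (this is the condition enforced by the history-based supervisor for the problem of robust satisfaction). Then μ_H({(x, x̂, q) | q ∈ F}) ≥ 1 − η; i.e., the controlled original system reaches an accepting DFA state within horizon H with probability at least 1 − η (Theorem 3 of the paper, stated for the effective Markov policy ρ realized by the Safe-visor architecture). -/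
set_option autoImplicit false

open Finset MeasureTheory

attribute [local instance] Classical.propDecidable

noncomputable section

variable {p : ℕ} {X Xh A Q U : Type*}

/-- The set `X̂'_ε(q)` of abstract states admitting a related concrete state whose
DFA successor from `q` is non-accepting. -/
def Xeps (h : X → EuclideanSpace ℝ (Fin p)) (hh : Xh → EuclideanSpace ℝ (Fin p))
    (L : EuclideanSpace ℝ (Fin p) → A) (τ : Q → A → Q) (F : Set Q) (ε : ℝ)
    [Fintype Xh] (q : Q) : Finset Xh :=
  Finset.univ.filter fun xh => ∃ x : X, τ q (L (h x)) ∉ F ∧ ‖h x - hh xh‖ ≤ ε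

/-- A robust history path of length `k`: `x̂(0)=x̂₀`, `q(0)=q̄₀`, and for `1 ≤ z ≤ k`,
`x̂(z) ∈ X̂'_ε(q(z−1))` and `q(z) ∈ Q'_ε(q(z−1), x̂(z)) \ F`. -/
def IsRobustHistory [Fintype Q] [Fintype Xh]
    (h : X → EuclideanSpace ℝ (Fin p)) (hh : Xh → EuclideanSpace ℝ (Fin p))
    (L : EuclideanSpace ℝ (Fin p) → A) (τ : Q → A → Q) (F : Set Q) (ε : ℝ)
    (xh0 : Xh) (qb0 : Q) (k : ℕ) (xhp : ℕ → Xh) (qp : ℕ → Q) : Prop :=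
  xhp 0 = xh0 ∧ qp 0 = qb0 ∧
    ∀ z, 1 ≤ z → z ≤ k →
      xhp z ∈ Xeps h hh L τ F ε (qp (z - 1)) ∧
      qp z ∈ Qeps h hh L τ ε (qp (z - 1)) (xhp z) ∧ qp z ∉ F

/-- The violation estimate `Ē_pv(k)` of a robust history path. -/
def Ebar [Fintype Q] [Fintype Xh]
    (h : X → EuclideanSpace ℝ (Fin p)) (hh : Xh → EuclideanSpace ℝ (Fin p))
    (L : EuclideanSpace ℝ (Fin p) → A) (τ : Q → A → Q) (ε : ℝ)
    (hQ : ∀ (q : Q) (x' : Xh), (Qeps h hh L τ ε q x').Nonempty)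
    (That : Xh → U → Xh → ℝ) (F : Set Q) (δ : ℝ) (H : ℕ) (ρ : ℕ → Xh × Q → U)
    (k : ℕ) (xhp : ℕ → Xh) (qp : ℕ → Q) : ℝ :=
  (∏ z ∈ Finset.Icc 1 k, ((1 - δ) *
      ∑ xh ∈ Xeps h hh L τ F ε (qp (z - 1)),
        That (xhp (z - 1)) (ρ (z - 1) (xhp (z - 1), qp (z - 1))) xh))
  * ((1 - δ) * (1 - ∑ xh : Xh,
      ((Qeps h hh L τ ε (qp k) xh).inf' (hQ (qp k) xh)
        fun q' => Vbar h hh L τ ε hQ That F δ H ρ (H - k - 1) (xh, q'))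
      * That (xhp k) (ρ k (xhp k, qp k)) xh))
  + δ
  + ∑ j ∈ Finset.Icc 1 k, δ * ∏ z ∈ Finset.Icc 1 j, ((1 - δ) *
      ∑ xh ∈ Xeps h hh L τ F ε (qp (z - 1)),
        That (xhp (z - 1)) (ρ (z - 1) (xhp (z - 1), qp (z - 1))) xh)

theorem statement6
    (hp : 1 ≤ p) [Nonempty X] [Fintype Xh] [Nonempty Xh] [Fintype A] [Fintype Q]
    [Fintype U] [Nonempty U]
    (h : X → EuclideanSpace ℝ (Fin p)) (hh : Xh → EuclideanSpace ℝ (Fin p))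
    (L : EuclideanSpace ℝ (Fin p) → A) (τ : Q → A → Q) (F : Set Q)
    (ε δ : ℝ) (hε : 0 ≤ ε) (hδ0 : 0 ≤ δ) (hδ1 : δ ≤ 1)
    (hcov : ∀ x' : Xh, ∃ x : X, ‖h x - hh x'‖ ≤ ε)
    (That : Xh → U → Xh → ℝ)
    (hT0 : ∀ xh u xh', 0 ≤ That xh u xh')
    (hT1 : ∀ xh u, ∑ xh' : Xh, That xh u xh' = 1)
    [MeasurableSpace X] [MeasurableSpace A] [DiscreteMeasurableSpace A]
    [MeasurableSpace Xh] [DiscreteMeasurableSpace Xh]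
    [MeasurableSpace Q] [DiscreteMeasurableSpace Q]
    [MeasurableSpace U] [DiscreteMeasurableSpace U]
    (hL : Measurable fun x : X => L (h x))
    (R : Set (X × Xh)) (hRmeas : MeasurableSet R)
    (hRout : ∀ s ∈ R, ‖h s.1 - hh s.2‖ ≤ ε)
    (x0 : X) (xh0 : Xh) (hR0 : (x0, xh0) ∈ R) (q0 : Q)
    (κ : X × Xh → U → Measure (X × Xh))
    (hκprob : ∀ s u, IsProbabilityMeasure (κ s u))
    (hκmeas : ∀ u : U, Measurable fun s : X × Xh => κ s u)
    (hκ1 : ∀ s ∈ R, ∀ (u : U) (xh' : Xh),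
      κ s u (Set.univ ×ˢ ({xh'} : Set Xh)) = ENNReal.ofReal (That s.2 u xh'))
    (hκ2 : ∀ s ∈ R, ∀ (u : U) (xh' : Xh),
      ENNReal.ofReal ((1 - δ) * That s.2 u xh') ≤
        κ s u {y : X × Xh | y.2 = xh' ∧ (y.1, xh') ∈ R})
    (H : ℕ) (hH : 1 ≤ H) (ρ : ℕ → Xh × Q → U)
    (hq0 : τ q0 (L (h x0)) ∉ F) (η : ℝ)
    (hsup : ∀ k < H, ∀ (xhp : ℕ → Xh) (qp : ℕ → Q),
      IsRobustHistory h hh L τ F ε xh0 (τ q0 (L (h x0))) k xhp qp →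
      Ebar h hh L τ ε (Qeps_nonempty h hh L τ ε hcov) That F δ H ρ k xhp qp ≤ η) :
    1 - η ≤ (muSeq h L τ F κ ρ (x0, xh0, τ q0 (L (h x0))) H
      {s : X × Xh × Q | s.2.2 ∈ F}).toReal := by
  have hV0 : ∀ n s, 0 ≤ Vbar h hh L τ ε (Qeps_nonempty h hh L τ ε hcov) That F δ H ρ n s := by
    intro n
    induction n with
    | zero => intro s; rw [Vbar]; split_ifs <;> norm_num
    | succ n ih =>
      intro s
      rw [Vbar]
      split_ifs
      · norm_num
      · refine mul_nonneg (by linarith) (Finset.sum_nonneg fun x' _ => mul_nonneg ?_ (hT0 _ _ _))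
        exact Finset.le_inf' _ _ fun q' _ => ih _
  have hVF : ∀ n (s : Xh × Q), s.2 ∈ F →
      Vbar h hh L τ ε (Qeps_nonempty h hh L τ ε hcov) That F δ H ρ n s = 1 := by
    intro n s hs
    cases n <;> simp [Vbar, hs]
  set V := Vbar h hh L τ ε (Qeps_nonempty h hh L τ ε hcov) That F δ H ρ with hV
  set μ := muSeq h L τ F κ ρ (x0, xh0, τ q0 (L (h x0))) with hμ
  -- the one-step kernel
  let K : ℕ → X × Xh × Q → Measure (X × Xh × Q) := fun k s =>
      if s.2.2 ∈ F then Measure.dirac s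
      else (κ (s.1, s.2.1) (ρ k (s.2.1, s.2.2))).map
        fun y : X × Xh => (y.1, y.2, τ s.2.2 (L (h y.1)))
  have hstep : ∀ k, μ (k + 1) = (μ k).bind (K k) := fun k => rfl
  have hfm : ∀ q : Q, Measurable fun y : X × Xh => (y.1, y.2, τ q (L (h y.1))) := by
    intro q
    have h1 : Measurable (τ q) := Measurable.of_discrete
    exact measurable_fst.prodMk (measurable_snd.prodMk (h1.comp (hL.comp measurable_fst)))
  have hKm : ∀ k, Measurable (K k) := by
    intro k
    refine measurable_from_prod_countable_left (fun y => ?_)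
    by_cases hy : y.2 ∈ F
    · simp only [K, hy, if_true]
      exact Measure.measurable_dirac.comp measurable_prodMk_right
    · simp only [K, hy, if_false]
      exact (Measure.measurable_map _ (hfm y.2)).comp
        ((hκmeas (ρ k (y.1, y.2))).comp measurable_prodMk_right)
  have hprob : ∀ k, IsProbabilityMeasure (μ k) := by
    intro k
    induction k with
    | zero => exact Measure.dirac.isProbabilityMeasure
    | succ k ih =>
      rw [hstep]
      refine isProbabilityMeasure_bind (hKm k).aemeasurable (Filter.Eventually.of_forall fun s => ?_)
      by_cases hs : s.2.2 ∈ F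
      · simp only [K, hs, if_true]; infer_instance
      · simp only [K, hs, if_false]
        have := hκprob (s.1, s.2.1) (ρ k (s.2.1, s.2.2))
        exact Measure.isProbabilityMeasure_map (hfm _).aemeasurable
  let Φ : ℕ → X × Xh × Q → ENNReal := fun n s =>
    if s.2.2 ∈ F ∨ (s.1, s.2.1) ∈ R then ENNReal.ofReal (V n s.2) else 0
  have hΦm : ∀ n, Measurable (Φ n) := by
    intro n
    refine measurable_from_prod_countable_left (fun y => ?_)
    change Measurable fun x => if y.2 ∈ F ∨ (x, y.1) ∈ R then ENNReal.ofReal (V n y) else 0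
    refine Measurable.ite ?_ measurable_const measurable_const
    by_cases hy : y.2 ∈ F
    · simp [hy]
    · simp only [hy, false_or]
      exact measurable_prodMk_right hRmeas
  have hpt : ∀ k n, k + n + 1 = H → ∀ s, Φ (n + 1) s ≤ ∫⁻ t, Φ n t ∂(K k s) := by
    intro k n hk s
    by_cases hs : s.2.2 ∈ F
    · simp only [K, hs, if_true]
      rw [lintegral_dirac' _ (hΦm n)]
      simp [Φ, hs, hVF]
    · simp only [K, hs, if_false]
      rw [lintegral_map (hΦm n) (hfm _)]
      by_cases hsR : (s.1, s.2.1) ∈ R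
      swap
      · simp [Φ, hs, hsR]
      have hkH : H - n - 1 = k := by omega
      set u := ρ k (s.2.1, s.2.2) with hu
      let m : Xh → ℝ := fun x' => (Qeps h hh L τ ε s.2.2 x').inf'
          (Qeps_nonempty h hh L τ ε hcov s.2.2 x') fun q' => V n (x', q')
      have hm0 : ∀ x', 0 ≤ m x' := fun x' => Finset.le_inf' _ _ fun q' _ => hV0 _ _
      let S : Xh → Set (X × Xh) := fun x' => {y : X × Xh | y.2 = x' ∧ (y.1, x') ∈ R}
      have hSm : ∀ x', MeasurableSet (S x') := by
        intro x'
        have h1 : MeasurableSet {y : X × Xh | y.2 = x'} :=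
          measurable_snd (measurableSet_singleton x')
        have h2 : MeasurableSet {y : X × Xh | (y.1, x') ∈ R} :=
          (measurable_fst.prodMk measurable_const) hRmeas
        exact h1.inter h2
      have hVs : V (n + 1) s.2 = ∑ x', m x' * ((1 - δ) * That s.2.1 u x') := by
        rw [hV, Vbar, if_neg hs, hkH, Finset.mul_sum]
        refine Finset.sum_congr rfl fun x' _ => ?_
        simp only [m, hu, hV]
        ring
      have hδ' : 0 ≤ 1 - δ := by linarith
      calc Φ (n + 1) s = ENNReal.ofReal (V (n + 1) s.2) := by simp [Φ, hsR]
        _ = ∑ x', ENNReal.ofReal (m x') * ENNReal.ofReal ((1 - δ) * That s.2.1 u x') := by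
          rw [hVs, ENNReal.ofReal_sum_of_nonneg
            (fun x' _ => mul_nonneg (hm0 x') (mul_nonneg hδ' (hT0 _ _ _)))]
          exact Finset.sum_congr rfl fun x' _ => ENNReal.ofReal_mul (hm0 x')
        _ ≤ ∑ x', ENNReal.ofReal (m x') * κ (s.1, s.2.1) u (S x') :=
          Finset.sum_le_sum fun x' _ => mul_le_mul_right (hκ2 _ hsR u x') _
        _ = ∫⁻ y, ∑ x', (S x').indicator (fun _ => ENNReal.ofReal (m x')) y
              ∂(κ (s.1, s.2.1) u) := by
          rw [lintegral_finsetSum _ fun x' _ => measurable_const.indicator (hSm x')]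
          exact Finset.sum_congr rfl fun x' _ => (lintegral_indicator_const (hSm x') _).symm
        _ ≤ _ := by
          refine lintegral_mono fun y => ?_
          rw [Finset.sum_eq_single y.2]
          · by_cases hy : y ∈ R
            · have hy' : y ∈ S y.2 := ⟨rfl, hy⟩
              rw [Set.indicator_of_mem hy']
              have : (y.1, y.2) ∈ R := hy
              simp only [Φ, this, or_true, if_true]
              refine ENNReal.ofReal_le_ofReal (Finset.inf'_le _ ?_)
              exact Finset.mem_filter.2 ⟨Finset.mem_univ _, y.1, rfl, hRout _ hy⟩
            · rw [Set.indicator_of_notMem (fun hc => hy hc.2)]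
              exact zero_le
          · intro b _ hb
            exact Set.indicator_of_notMem (fun hc => hb hc.1.symm) _
          · simp
  have hmain : ∀ k n, k + n = H → ENNReal.ofReal (V H (xh0, τ q0 (L (h x0)))) ≤
      ∫⁻ s, Φ n s ∂(μ k) := by
    intro k
    induction k with
    | zero =>
      intro n hn
      obtain rfl : n = H := by omega
      have : μ 0 = Measure.dirac (x0, xh0, τ q0 (L (h x0))) := rfl
      rw [this, lintegral_dirac' _ (hΦm _)]
      simp [Φ, hR0]
    | succ k ih =>
      intro n hn
      refine (ih (n + 1) (by omega)).trans ?_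
      rw [hstep, Measure.lintegral_bind (hKm k).aemeasurable (hΦm n).aemeasurable]
      exact lintegral_mono fun s => hpt k n (by omega) s
  have hFm : MeasurableSet {s : X × Xh × Q | s.2.2 ∈ F} :=
    (measurable_snd.comp measurable_snd) (MeasurableSet.of_discrete (s := F))
  have hfin := hmain H 0 rfl
  have hΦ0 : ∀ s, Φ 0 s ≤ {s : X × Xh × Q | s.2.2 ∈ F}.indicator 1 s := by
    intro s
    by_cases hs : s.2.2 ∈ F
    · simp [Φ, hs, hVF]
    · simp [Φ, hs, hV, Vbar]
  have hle : ENNReal.ofReal (V H (xh0, τ q0 (L (h x0)))) ≤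
      μ H {s : X × Xh × Q | s.2.2 ∈ F} := by
    rw [← lintegral_indicator_one hFm]
    exact hfin.trans (lintegral_mono hΦ0)
  have hE := hsup 0 (by omega) (fun _ => xh0) (fun _ => τ q0 (L (h x0)))
    ⟨rfl, rfl, fun z h1 h2 => by omega⟩
  have hVH : V H (xh0, τ q0 (L (h x0))) = 1 - Ebar h hh L τ ε (Qeps_nonempty h hh L τ ε hcov)
      That F δ H ρ 0 (fun _ => xh0) (fun _ => τ q0 (L (h x0))) := by
    obtain ⟨n, rfl⟩ : ∃ n, H = n + 1 := ⟨H - 1, by omega⟩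
    rw [hV, Vbar, if_neg hq0, Ebar]
    simp
    ring
  have hne : μ H {s : X × Xh × Q | s.2.2 ∈ F} ≠ ⊤ := measure_ne_top _ _
  have := (ENNReal.ofReal_le_iff_le_toReal hne).1 hle
  linarith

end
end

section
/- Assume q̄₀ ∉ F, and let η ∈ ℝ be such that for every 0 ≤ k ≤ H−1 and every violation history path of length k for ρ one has E̲_pv(k) ≤ η (this is the condition enforced by the history-based supervisor for the problem of worst-case violation). Then μ_H({(x, x̂, q) | q ∈ F}) ≤ η; i.e., the controlled original system reaches an accepting DFA state (a bad prefix) within horizon H with probability at most η (Theorem 4 of the paper, stated for the effective Markov policy ρ realized by the Safe-visor architecture). -/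
set_option autoImplicit false

open Finset MeasureTheory

attribute [local instance] Classical.propDecidable

noncomputable section

variable {p : ℕ} {X Xh A Q U : Type*}

/-- The set `X̂'_{−ε}(q)` of abstract states all of whose related concrete states have
non-accepting DFA successor from `q`. -/
def Xmeps (h : X → EuclideanSpace ℝ (Fin p)) (hh : Xh → EuclideanSpace ℝ (Fin p))
    (L : EuclideanSpace ℝ (Fin p) → A) (τ : Q → A → Q) (F : Set Q) (ε : ℝ)
    [Fintype Xh] (q : Q) : Finset Xh :=
  Finset.univ.filter fun xh => ∀ x : X, ‖h x - hh xh‖ ≤ ε → τ q (L (h x)) ∉ F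

/-- A violation history path of length `k`: `x̂(0)=x̂₀`, `q(0)=q̄₀`, and for `1 ≤ z ≤ k`,
`x̂(z) ∈ X̂'_{−ε}(q(z−1))` and `q(z) ∈ Q'_ε(q(z−1), x̂(z))`. -/
def IsViolHistory [Fintype Q] [Fintype Xh]
    (h : X → EuclideanSpace ℝ (Fin p)) (hh : Xh → EuclideanSpace ℝ (Fin p))
    (L : EuclideanSpace ℝ (Fin p) → A) (τ : Q → A → Q) (F : Set Q) (ε : ℝ)
    (xh0 : Xh) (qb0 : Q) (k : ℕ) (xhp : ℕ → Xh) (qp : ℕ → Q) : Prop :=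
  xhp 0 = xh0 ∧ qp 0 = qb0 ∧
    ∀ z, 1 ≤ z → z ≤ k →
      xhp z ∈ Xmeps h hh L τ F ε (qp (z - 1)) ∧
      qp z ∈ Qeps h hh L τ ε (qp (z - 1)) (xhp z)

/-- The violation estimate `E̲_pv(k)` of a violation history path. -/
def Eund [Fintype Q] [Fintype Xh]
    (h : X → EuclideanSpace ℝ (Fin p)) (hh : Xh → EuclideanSpace ℝ (Fin p))
    (L : EuclideanSpace ℝ (Fin p) → A) (τ : Q → A → Q) (ε : ℝ)
    (hQ : ∀ (q : Q) (x' : Xh), (Qeps h hh L τ ε q x').Nonempty)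
    (That : Xh → U → Xh → ℝ) (F : Set Q) (δ : ℝ) (H : ℕ) (ρ : ℕ → Xh × Q → U)
    (k : ℕ) (xhp : ℕ → Xh) (qp : ℕ → Q) : ℝ :=
  1 - (∏ z ∈ Finset.Icc 1 k, ((1 - δ) *
      ∑ xh ∈ Xmeps h hh L τ F ε (qp (z - 1)),
        That (xhp (z - 1)) (ρ (z - 1) (xhp (z - 1), qp (z - 1))) xh))
    * ((1 - δ) * (1 - ∑ xh : Xh,
      ((Qeps h hh L τ ε (qp k) xh).sup' (hQ (qp k) xh)
        fun q' => Vunder h hh L τ ε hQ That F δ H ρ (H - k - 1) (xh, q'))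
      * That (xhp k) (ρ k (xhp k, qp k)) xh))

lemma Vunder_F [Fintype Q] [Fintype Xh]
    (h : X → EuclideanSpace ℝ (Fin p)) (hh : Xh → EuclideanSpace ℝ (Fin p))
    (L : EuclideanSpace ℝ (Fin p) → A) (τ : Q → A → Q) (ε : ℝ)
    (hQ : ∀ (q : Q) (x' : Xh), (Qeps h hh L τ ε q x').Nonempty)
    (That : Xh → U → Xh → ℝ) (F : Set Q) (δ : ℝ) (H : ℕ) (ρ : ℕ → Xh × Q → U)
    (n : ℕ) (s : Xh × Q) (hs : s.2 ∈ F) :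
    Vunder h hh L τ ε hQ That F δ H ρ n s = 1 := by
  cases n <;> simp [Vunder, hs]

lemma Vunder_bounds [Fintype Q] [Fintype Xh]
    (h : X → EuclideanSpace ℝ (Fin p)) (hh : Xh → EuclideanSpace ℝ (Fin p))
    (L : EuclideanSpace ℝ (Fin p) → A) (τ : Q → A → Q) (ε : ℝ)
    (hQ : ∀ (q : Q) (x' : Xh), (Qeps h hh L τ ε q x').Nonempty)
    (That : Xh → U → Xh → ℝ) (F : Set Q) (δ : ℝ) (hδ0 : 0 ≤ δ) (hδ1 : δ ≤ 1)
    (hT0 : ∀ xh u xh', 0 ≤ That xh u xh')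
    (hT1 : ∀ xh u, ∑ xh' : Xh, That xh u xh' = 1)
    (H : ℕ) (ρ : ℕ → Xh × Q → U) (n : ℕ) : ∀ s : Xh × Q,
    0 ≤ Vunder h hh L τ ε hQ That F δ H ρ n s ∧
      Vunder h hh L τ ε hQ That F δ H ρ n s ≤ 1 := by
  induction n with
  | zero => intro s; simp only [Vunder]; split_ifs <;> norm_num
  | succ n ih =>
    intro s
    simp only [Vunder]
    split_ifs
    · norm_num
    · have hM0 : ∀ x', 0 ≤ (Qeps h hh L τ ε s.2 x').sup' (hQ s.2 x')
          fun q' => Vunder h hh L τ ε hQ That F δ H ρ n (x', q') := by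
        intro x'
        obtain ⟨q', hq'⟩ := hQ s.2 x'
        exact (ih (x', q')).1.trans (Finset.le_sup' (fun q' => Vunder h hh L τ ε hQ That F δ H ρ n (x', q')) hq')
      have hM1 : ∀ x', ((Qeps h hh L τ ε s.2 x').sup' (hQ s.2 x')
          fun q' => Vunder h hh L τ ε hQ That F δ H ρ n (x', q')) ≤ 1 :=
        fun x' => Finset.sup'_le _ _ fun q' _ => (ih (x', q')).2
      have h0 : 0 ≤ ∑ x' : Xh, ((Qeps h hh L τ ε s.2 x').sup' (hQ s.2 x')
          fun q' => Vunder h hh L τ ε hQ That F δ H ρ n (x', q'))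
            * That s.1 (ρ (H - n - 1) s) x' :=
        Finset.sum_nonneg fun x' _ => mul_nonneg (hM0 x') (hT0 _ _ _)
      have h1 : ∑ x' : Xh, ((Qeps h hh L τ ε s.2 x').sup' (hQ s.2 x')
          fun q' => Vunder h hh L τ ε hQ That F δ H ρ n (x', q'))
            * That s.1 (ρ (H - n - 1) s) x' ≤ 1 := by
        rw [← hT1 s.1 (ρ (H - n - 1) s)]
        exact Finset.sum_le_sum fun x' _ => mul_le_of_le_one_left (hT0 _ _ _) (hM1 x')
      constructor <;> nlinarith

/-- One step of the probabilistic argument. -/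
lemma step_bound [Fintype Xh] [MeasurableSpace X] [MeasurableSpace Xh]
    [DiscreteMeasurableSpace Xh]
    (R : Set (X × Xh)) (hR : MeasurableSet R) (κ : Measure (X × Xh)) [IsProbabilityMeasure κ]
    (T M : Xh → ℝ) (δ : ℝ) (hδ1 : δ ≤ 1) (hT0 : ∀ x, 0 ≤ T x)
    (hT1 : ∑ x, T x = 1) (hM1 : ∀ x, M x ≤ 1)
    (hκ : ∀ x', ENNReal.ofReal ((1 - δ) * T x') ≤ κ {y : X × Xh | y.2 = x' ∧ (y.1, x') ∈ R})
    (G : X × Xh → ENNReal) (hG1 : ∀ y, G y ≤ 1)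
    (hG : ∀ y ∈ R, G y + ENNReal.ofReal (1 - M y.2) ≤ 1) :
    ∫⁻ y, G y ∂κ ≤ ENNReal.ofReal ((1 - δ) * (∑ x', M x' * T x') + δ) := by
  have hA : ∀ x', MeasurableSet {y : X × Xh | y.2 = x' ∧ (y.1, x') ∈ R} := by
    intro x'
    have : {y : X × Xh | y.2 = x' ∧ (y.1, x') ∈ R} = (Prod.snd ⁻¹' {x'}) ∩ R := by
      ext ⟨a, b⟩
      simp only [Set.mem_setOf_eq, Set.mem_inter_iff, Set.mem_preimage, Set.mem_singleton_iff]
      constructor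
      · rintro ⟨rfl, h⟩; exact ⟨rfl, h⟩
      · rintro ⟨rfl, h⟩; exact ⟨rfl, h⟩
    rw [this]
    exact (measurable_snd (measurableSet_singleton x')).inter hR
  have hmI : ∀ x', Measurable (Set.indicator {y : X × Xh | y.2 = x' ∧ (y.1, x') ∈ R}
      fun _ => ENNReal.ofReal (1 - M x')) := fun x' => measurable_const.indicator (hA x')
  have key : ∀ y, G y + ∑ x', Set.indicator {y : X × Xh | y.2 = x' ∧ (y.1, x') ∈ R}
      (fun _ => ENNReal.ofReal (1 - M x')) y ≤ 1 := by
    intro y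
    rw [Finset.sum_eq_single y.2]
    · by_cases hy : y ∈ R
      · have : y ∈ {z : X × Xh | z.2 = y.2 ∧ (z.1, y.2) ∈ R} := ⟨rfl, hy⟩
        rw [Set.indicator_of_mem this]
        exact hG y hy
      · have : y ∉ {z : X × Xh | z.2 = y.2 ∧ (z.1, y.2) ∈ R} := fun h => hy h.2
        rw [Set.indicator_of_notMem this, add_zero]
        exact hG1 y
    · intro b _ hb
      exact Set.indicator_of_notMem (fun h => hb h.1.symm) _
    · simp
  have h1 := lintegral_mono (μ := κ) key
  rw [lintegral_add_right _ (Finset.measurable_fun_sum _ fun x' _ => hmI x'),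
    lintegral_finsetSum _ (fun x' _ => hmI x')] at h1
  simp only [lintegral_const, measure_univ, mul_one] at h1
  have h2 : ENNReal.ofReal (∑ x', (1 - M x') * ((1 - δ) * T x')) ≤
      ∑ x', ∫⁻ y, Set.indicator {y : X × Xh | y.2 = x' ∧ (y.1, x') ∈ R}
      (fun _ => ENNReal.ofReal (1 - M x')) y ∂κ := by
    rw [ENNReal.ofReal_sum_of_nonneg]
    · refine Finset.sum_le_sum fun x' _ => ?_
      rw [lintegral_indicator_const (hA x'), ENNReal.ofReal_mul (by linarith [hM1 x'])]
      gcongr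
      exact hκ x'
    · intro x' _
      exact mul_nonneg (by linarith [hM1 x']) (mul_nonneg (by linarith) (hT0 x'))
  have h3 : 0 ≤ ∑ x', (1 - M x') * ((1 - δ) * T x') := Finset.sum_nonneg fun x' _ =>
    mul_nonneg (by linarith [hM1 x']) (mul_nonneg (by linarith) (hT0 x'))
  have h4 : (1 - δ) * (∑ x', M x' * T x') + δ = 1 - ∑ x', (1 - M x') * ((1 - δ) * T x') := by
    have : ∑ x', (1 - M x') * ((1 - δ) * T x')
        = (1 - δ) * ∑ x', T x' - (1 - δ) * ∑ x', M x' * T x' := by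
      rw [Finset.mul_sum, Finset.mul_sum, ← Finset.sum_sub_distrib]
      exact Finset.sum_congr rfl fun x' _ => by ring
    rw [this, hT1]; ring
  rw [h4, ENNReal.ofReal_sub _ h3, ENNReal.ofReal_one]
  refine ENNReal.le_sub_of_add_le_right ENNReal.ofReal_ne_top ?_
  exact (add_le_add_right h2 _).trans h1

theorem statement7
    (hp : 1 ≤ p) [Nonempty X] [Fintype Xh] [Nonempty Xh] [Fintype A] [Fintype Q]
    [Fintype U] [Nonempty U]
    (h : X → EuclideanSpace ℝ (Fin p)) (hh : Xh → EuclideanSpace ℝ (Fin p))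
    (L : EuclideanSpace ℝ (Fin p) → A) (τ : Q → A → Q) (F : Set Q)
    (ε δ : ℝ) (hε : 0 ≤ ε) (hδ0 : 0 ≤ δ) (hδ1 : δ ≤ 1)
    (hcov : ∀ x' : Xh, ∃ x : X, ‖h x - hh x'‖ ≤ ε)
    (That : Xh → U → Xh → ℝ)
    (hT0 : ∀ xh u xh', 0 ≤ That xh u xh')
    (hT1 : ∀ xh u, ∑ xh' : Xh, That xh u xh' = 1)
    [MeasurableSpace X] [MeasurableSpace A] [DiscreteMeasurableSpace A]
    [MeasurableSpace Xh] [DiscreteMeasurableSpace Xh]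
    [MeasurableSpace Q] [DiscreteMeasurableSpace Q]
    [MeasurableSpace U] [DiscreteMeasurableSpace U]
    (hL : Measurable fun x : X => L (h x))
    (R : Set (X × Xh)) (hRmeas : MeasurableSet R)
    (hRout : ∀ s ∈ R, ‖h s.1 - hh s.2‖ ≤ ε)
    (x0 : X) (xh0 : Xh) (hR0 : (x0, xh0) ∈ R) (q0 : Q)
    (κ : X × Xh → U → Measure (X × Xh))
    (hκprob : ∀ s u, IsProbabilityMeasure (κ s u))
    (hκmeas : ∀ u : U, Measurable fun s : X × Xh => κ s u)
    (hκ1 : ∀ s ∈ R, ∀ (u : U) (xh' : Xh),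
      κ s u (Set.univ ×ˢ ({xh'} : Set Xh)) = ENNReal.ofReal (That s.2 u xh'))
    (hκ2 : ∀ s ∈ R, ∀ (u : U) (xh' : Xh),
      ENNReal.ofReal ((1 - δ) * That s.2 u xh') ≤
        κ s u {y : X × Xh | y.2 = xh' ∧ (y.1, xh') ∈ R})
    (H : ℕ) (hH : 1 ≤ H) (ρ : ℕ → Xh × Q → U)
    (hq0 : τ q0 (L (h x0)) ∉ F) (η : ℝ)
    (hsup : ∀ k < H, ∀ (xhp : ℕ → Xh) (qp : ℕ → Q),
      IsViolHistory h hh L τ F ε xh0 (τ q0 (L (h x0))) k xhp qp →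
      Eund h hh L τ ε (Qeps_nonempty h hh L τ ε hcov) That F δ H ρ k xhp qp ≤ η) :
    (muSeq h L τ F κ ρ (x0, xh0, τ q0 (L (h x0))) H
      {s : X × Xh × Q | s.2.2 ∈ F}).toReal ≤ η := by
  have hQ := Qeps_nonempty h hh L τ ε hcov
  set V := Vunder h hh L τ ε (Qeps_nonempty h hh L τ ε hcov) That F δ H ρ with hV
  have hVb : ∀ n s, 0 ≤ V n s ∧ V n s ≤ 1 := fun n =>
    Vunder_bounds h hh L τ ε (Qeps_nonempty h hh L τ ε hcov) That F δ hδ0 hδ1 hT0 hT1 H ρ n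
  have hVF : ∀ n s, s.2 ∈ F → V n s = 1 := fun n s hs =>
    Vunder_F h hh L τ ε (Qeps_nonempty h hh L τ ε hcov) That F δ H ρ n s hs
  let W : ℕ → X × Xh × Q → ENNReal := fun n s =>
    if (s.1, s.2.1) ∈ R then ENNReal.ofReal (V n s.2) else 1
  have hW1 : ∀ n s, W n s ≤ 1 := by
    intro n s
    simp only [W]
    split_ifs
    · exact ENNReal.ofReal_le_one.2 (hVb n s.2).2
    · exact le_rfl
  have hWF : ∀ n s, s.2.2 ∈ F → W n s = 1 := by
    intro n s hs
    simp only [W, hVF n s.2 hs, ENNReal.ofReal_one, ite_self]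
  have hWm : ∀ n, Measurable (W n) := by
    intro n
    refine measurable_from_prod_countable_left fun y => ?_
    change Measurable fun x : X => if (x, y.1) ∈ R then ENNReal.ofReal (V n y) else 1
    refine Measurable.ite ?_ measurable_const measurable_const
    exact (measurable_id.prodMk measurable_const : Measurable fun x : X => (x, y.1)) hRmeas
  have hf : ∀ q : Q, Measurable fun y : X × Xh => (y.1, y.2, τ q (L (h y.1))) := by
    intro q
    exact measurable_fst.prodMk (measurable_snd.prodMk
      ((measurable_of_countable (τ q)).comp (hL.comp measurable_fst)))
  have hKm : ∀ k, Measurable fun s : X × Xh × Q =>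
      if s.2.2 ∈ F then Measure.dirac s
      else (κ (s.1, s.2.1) (ρ k (s.2.1, s.2.2))).map
        fun y : X × Xh => (y.1, y.2, τ s.2.2 (L (h y.1))) := by
    intro k
    refine measurable_from_prod_countable_left fun y => ?_
    by_cases hy : y.2 ∈ F
    · simp only [hy, if_true]
      exact Measure.measurable_dirac.comp (measurable_id.prodMk measurable_const)
    · simp only [hy, if_false]
      exact (Measure.measurable_map _ (hf y.2)).comp
        ((hκmeas _).comp (measurable_id.prodMk measurable_const))
  set μ := muSeq h L τ F κ ρ (x0, xh0, τ q0 (L (h x0))) with hμ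
  have hstep : ∀ k n, k + n + 1 = H → ∫⁻ s, W n s ∂(μ (k + 1)) ≤ ∫⁻ s, W (n + 1) s ∂(μ k) := by
    intro k n hkn
    simp only [hμ, muSeq]
    rw [Measure.lintegral_bind (hKm k).aemeasurable (hWm n).aemeasurable]
    refine lintegral_mono fun s => ?_
    by_cases hs : s.2.2 ∈ F
    · simp only [hs, if_true]
      rw [lintegral_dirac' _ (hWm n), hWF _ _ hs, hWF _ _ hs]
    · simp only [hs, if_false]
      rw [lintegral_map (hWm n) (hf _)]
      haveI := hκprob (s.1, s.2.1) (ρ k (s.2.1, s.2.2))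
      by_cases hsR : (s.1, s.2.1) ∈ R
      · have hk : H - n - 1 = k := by omega
        have e : W (n + 1) s = ENNReal.ofReal ((1 - δ) * (∑ x' : Xh,
          ((Qeps h hh L τ ε s.2.2 x').sup' (hQ s.2.2 x') fun q' => V n (x', q'))
            * That s.2.1 (ρ k s.2) x') + δ) := by
          simp only [W, hsR, if_true, hV, Vunder, hs, if_false, hk]
        rw [e]
        refine step_bound R hRmeas _ _ _ δ hδ1 (hT0 _ _) (hT1 _ _)
          (fun x' => Finset.sup'_le _ _ fun q' _ => (hVb n (x', q')).2)
          (fun x' => hκ2 _ hsR _ x') _ (fun y => hW1 _ _) ?_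
        intro y hy
        have hmem : τ s.2.2 (L (h y.1)) ∈ Qeps h hh L τ ε s.2.2 y.2 :=
          Finset.mem_filter.2 ⟨Finset.mem_univ _, y.1, rfl, hRout y hy⟩
        have hle := Finset.le_sup' (fun q' => V n (y.2, q')) hmem
        have hM1 : ((Qeps h hh L τ ε s.2.2 y.2).sup' (hQ s.2.2 y.2)
            fun q' => V n (y.2, q')) ≤ 1 :=
          Finset.sup'_le _ _ fun q' _ => (hVb n (y.2, q')).2
        have hy' : (y.1, y.2) ∈ R := hy
        simp only [W, hy', if_true]
        rw [← ENNReal.ofReal_add (hVb _ _).1 (by linarith)]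
        refine ENNReal.ofReal_le_one.2 ?_
        linarith
      · have e : W (n + 1) s = 1 := by simp only [W, hsR, if_false]
        rw [e]
        refine (lintegral_mono fun y => hW1 n _).trans ?_
        simp
  have hiter : ∀ n, n ≤ H → ∫⁻ s, W 0 s ∂(μ H) ≤ ∫⁻ s, W n s ∂(μ (H - n)) := by
    intro n
    induction n with
    | zero => intro _; exact le_rfl
    | succ n ih =>
      intro hn
      have e : H - n = (H - (n + 1)) + 1 := by omega
      have h1 := ih (by omega)
      rw [e] at h1
      exact h1.trans (hstep _ _ (by omega))
  have hfin : μ H {s : X × Xh × Q | s.2.2 ∈ F} ≤ ENNReal.ofReal (V H (xh0, τ q0 (L (h x0)))) := by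
    have hFm : MeasurableSet {s : X × Xh × Q | s.2.2 ∈ F} :=
      (measurable_snd.comp measurable_snd) (MeasurableSet.of_discrete (s := F))
    calc μ H {s : X × Xh × Q | s.2.2 ∈ F}
        = ∫⁻ s, Set.indicator {s : X × Xh × Q | s.2.2 ∈ F} 1 s ∂(μ H) :=
          (lintegral_indicator_one hFm).symm
      _ ≤ ∫⁻ s, W 0 s ∂(μ H) := by
          refine lintegral_mono fun s => ?_
          refine Set.indicator_apply_le fun hs => ?_
          exact (hWF 0 s hs).ge
      _ ≤ ∫⁻ s, W H s ∂(μ (H - H)) := hiter H le_rfl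
      _ = _ := by
          rw [Nat.sub_self]
          simp only [hμ, muSeq]
          rw [lintegral_dirac' _ (hWm H)]
          simp only [W, hR0, if_true]
  have hE := hsup 0 (by omega) (fun _ => xh0) (fun _ => τ q0 (L (h x0)))
    ⟨rfl, rfl, fun z h1 h2 => by omega⟩
  have hVE : V H (xh0, τ q0 (L (h x0))) ≤ η := by
    obtain ⟨m, rfl⟩ : ∃ m, H = m + 1 := ⟨H - 1, by omega⟩
    refine le_trans (le_of_eq ?_) hE
    have e : m + 1 - m - 1 = 0 := by omega
    simp only [hV, Eund]
    rw [Vunder]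
    simp [hq0, e]
    ring
  exact (ENNReal.toReal_le_of_le_ofReal (hVb _ _).1 hfin).trans hVE

end
end

section
/- Fix x̂₀ ∈ X̂, q̄₀ ∈ Q with q̄₀ ∉ F, a Markov policy ρ over horizon H ≥ 1, and 0 ≤ k ≤ H−1. For a sequence (x̂(1), …, x̂(j)) ∈ X̂^j set x̂(0) := x̂₀, q(0) := q̄₀ and recursively q(z) := q̲_{H−z}(q(z−1), x̂(z)), and call the sequence admissible if x̂(z) ∈ X̂'_ε(q(z−1)) for all 1 ≤ z ≤ j. Then 1 − V̄^ρ_H(x̂₀, q̄₀) = θ₁(k) + θ₂(k), where θ₁(k) := (1−δ)^{k+1} · ∑_{admissible (x̂(1),…,x̂(k))} (∏_{z=1}^{k} T̂ (x̂(z−1)) (ρ_{z−1}(x̂(z−1), q(z−1))) (x̂(z))) · (1 − ∑_{x̂' ∈ X̂} V̄^ρ_{H−k−1}(x̂', q̲_{H−k−1}(q(k), x̂')) · T̂ (x̂(k)) (ρ_k(x̂(k), q(k))) x̂'), and θ₂(k) := δ · ∑_{j=0}^{k} (1−δ)^j · ∑_{admissible (x̂(1),…,x̂(j))} ∏_{z=1}^{j}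 T̂ (x̂(z−1)) (ρ_{z−1}(x̂(z−1), q(z−1))) (x̂(z)) (the k-step expansion identity established in the proof of Theorem 3 of the paper). -/
set_option autoImplicit false

open Finset MeasureTheory

attribute [local instance] Classical.propDecidable

noncomputable section

variable {p : ℕ} {X Xh A Q U : Type*}

/-- DFA state path `q(z)` induced by a selection map `q̲` along an
abstract-state sequence: `q(0) = q₀` and `q(z) = q̲_{H−z}(q(z−1), x̂(z))`. -/
def qpath (qsel : ℕ → Q × Xh → Q) (H : ℕ) (q0 : Q) (xs : ℕ → Xh) : ℕ → Q
  | 0 => q0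
  | z + 1 => qsel (H - (z + 1)) (qpath qsel H q0 xs z, xs (z + 1))

/-- Extension of a finite sequence `(x̂(1), …, x̂(k))` to `ℕ`, with `x̂(0) := x̂₀`. -/
def extSeq (xh0 : Xh) {k : ℕ} (s : Fin k → Xh) : ℕ → Xh :=
  fun z => if hz : 1 ≤ z ∧ z ≤ k then s ⟨z - 1, by omega⟩ else xh0

/-- Admissibility of a sequence `(x̂(1), …, x̂(k))`: `x̂(z) ∈ X̂'_ε(q(z−1))` for all `1 ≤ z ≤ k`. -/
def AdmissibleR [Fintype Q] [Fintype Xh]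
    (h : X → EuclideanSpace ℝ (Fin p)) (hh : Xh → EuclideanSpace ℝ (Fin p))
    (L : EuclideanSpace ℝ (Fin p) → A) (τ : Q → A → Q) (F : Set Q) (ε : ℝ)
    (qsel : ℕ → Q × Xh → Q) (H : ℕ) (xh0 : Xh) (qb0 : Q) {k : ℕ}
    (s : Fin k → Xh) : Prop :=
  ∀ z, 1 ≤ z → z ≤ k →
    extSeq xh0 s z ∈ Xeps h hh L τ F ε (qpath qsel H qb0 (extSeq xh0 s) (z - 1))

lemma qpath_congr12 (qsel : ℕ → Q × Xh → Q) (H : ℕ) (q0 : Q) (xs ys : ℕ → Xh) (n : ℕ)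
    (hxy : ∀ z, 1 ≤ z → z ≤ n → xs z = ys z) :
    qpath qsel H q0 xs n = qpath qsel H q0 ys n := by
  induction n with
  | zero => rfl
  | succ n ih =>
    simp only [qpath]
    rw [ih (fun z h1 h2 => hxy z h1 (by omega)), hxy (n + 1) (by omega) le_rfl]

lemma extSeq_snoc12 (xh0 : Xh) {k : ℕ} (s : Fin k → Xh) (x : Xh) (z : ℕ) (hz : z ≤ k) :
    extSeq xh0 (Fin.snoc (α := fun _ => Xh) s x) z = extSeq xh0 s z := by
  unfold extSeq
  by_cases h1 : 1 ≤ z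
  · rw [dif_pos ⟨h1, by omega⟩, dif_pos ⟨h1, hz⟩]
    have : (⟨z - 1, by omega⟩ : Fin (k + 1)) = Fin.castSucc ⟨z - 1, by omega⟩ := rfl
    rw [this, Fin.snoc_castSucc]
  · rw [dif_neg (by omega), dif_neg (by omega)]

lemma extSeq_last12 (xh0 : Xh) {k : ℕ} (s : Fin k → Xh) (x : Xh) :
    extSeq xh0 (Fin.snoc (α := fun _ => Xh) s x) (k + 1) = x := by
  unfold extSeq
  rw [dif_pos ⟨by omega, le_rfl⟩]
  have : (⟨k + 1 - 1, by omega⟩ : Fin (k + 1)) = Fin.last k := rfl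
  rw [this, Fin.snoc_last]

lemma qpath_snoc12 (qsel : ℕ → Q × Xh → Q) (H : ℕ) (q0 : Q) (xh0 : Xh) {k : ℕ}
    (s : Fin k → Xh) (x : Xh) (z : ℕ) (hz : z ≤ k) :
    qpath qsel H q0 (extSeq xh0 (Fin.snoc (α := fun _ => Xh) s x)) z
      = qpath qsel H q0 (extSeq xh0 s) z :=
  qpath_congr12 _ _ _ _ _ _ fun w _ h2 => extSeq_snoc12 xh0 s x w (by omega)

lemma qpath_last12 (qsel : ℕ → Q × Xh → Q) (H : ℕ) (q0 : Q) (xh0 : Xh) {k : ℕ}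
    (s : Fin k → Xh) (x : Xh) :
    qpath qsel H q0 (extSeq xh0 (Fin.snoc (α := fun _ => Xh) s x)) (k + 1)
      = qsel (H - (k + 1)) (qpath qsel H q0 (extSeq xh0 s) k, x) := by
  simp only [qpath]
  rw [qpath_snoc12 _ _ _ _ _ _ _ le_rfl, extSeq_last12]

lemma sum_snoc12 [Fintype Xh] {k : ℕ} (f : (Fin (k + 1) → Xh) → ℝ) :
    ∑ s : Fin (k + 1) → Xh, f s
      = ∑ s : Fin k → Xh, ∑ x : Xh, f (Fin.snoc (α := fun _ => Xh) s x) := by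
  rw [Finset.sum_comm, ← Fintype.sum_prod_type']
  exact (Equiv.sum_comp (Fin.snocEquiv (fun _ => Xh)) f).symm

lemma adm_snoc12 [Fintype Q] [Fintype Xh]
    (h : X → EuclideanSpace ℝ (Fin p)) (hh : Xh → EuclideanSpace ℝ (Fin p))
    (L : EuclideanSpace ℝ (Fin p) → A) (τ : Q → A → Q) (F : Set Q) (ε : ℝ)
    (qsel : ℕ → Q × Xh → Q) (H : ℕ) (xh0 : Xh) (qb0 : Q) {k : ℕ}
    (s : Fin k → Xh) (x : Xh) :
    AdmissibleR h hh L τ F ε qsel H xh0 qb0 (Fin.snoc (α := fun _ => Xh) s x) ↔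
      AdmissibleR h hh L τ F ε qsel H xh0 qb0 s ∧
        x ∈ Xeps h hh L τ F ε (qpath qsel H qb0 (extSeq xh0 s) k) := by
  unfold AdmissibleR
  constructor
  · intro hs
    refine ⟨fun z h1 h2 => ?_, ?_⟩
    · have := hs z h1 (by omega)
      rwa [extSeq_snoc12 _ _ _ _ h2, qpath_snoc12 _ _ _ _ _ _ _ (by omega)] at this
    · have := hs (k + 1) (by omega) le_rfl
      rwa [extSeq_last12, Nat.add_sub_cancel, qpath_snoc12 _ _ _ _ _ _ _ le_rfl] at this
  · rintro ⟨hs, hx⟩ z h1 h2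
    rcases Nat.lt_or_ge k z with h3 | h3
    · obtain rfl : z = k + 1 := by omega
      rwa [extSeq_last12, Nat.add_sub_cancel, qpath_snoc12 _ _ _ _ _ _ _ le_rfl]
    · rw [extSeq_snoc12 _ _ _ _ h3, qpath_snoc12 _ _ _ _ _ _ _ (by omega)]
      exact hs z h1 h3

theorem statement12
    (hp : 1 ≤ p) [Nonempty X] [Fintype Xh] [Nonempty Xh] [Fintype A] [Fintype Q]
    [Fintype U] [Nonempty U]
    (h : X → EuclideanSpace ℝ (Fin p)) (hh : Xh → EuclideanSpace ℝ (Fin p))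
    (L : EuclideanSpace ℝ (Fin p) → A) (τ : Q → A → Q) (F : Set Q)
    (ε δ : ℝ) (hε : 0 ≤ ε) (hδ0 : 0 ≤ δ) (hδ1 : δ ≤ 1)
    (hcov : ∀ x' : Xh, ∃ x : X, ‖h x - hh x'‖ ≤ ε)
    (That : Xh → U → Xh → ℝ)
    (hT0 : ∀ xh u xh', 0 ≤ That xh u xh')
    (hT1 : ∀ xh u, ∑ xh' : Xh, That xh u xh' = 1)
    (H : ℕ) (hH : 1 ≤ H) (ρ : ℕ → Xh × Q → U)
    (xh0 : Xh) (qb0 : Q) (hq0 : qb0 ∉ F) (k : ℕ) (hk : k < H)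
    (qsel : ℕ → Q × Xh → Q)
    (hsel_mem : ∀ n ≤ H, ∀ (q : Q) (x' : Xh), qsel n (q, x') ∈ Qeps h hh L τ ε q x')
    (hsel_min : ∀ n ≤ H, ∀ (q : Q) (x' : Xh),
      Vbar h hh L τ ε (Qeps_nonempty h hh L τ ε hcov) That F δ H ρ n (x', qsel n (q, x')) =
        (Qeps h hh L τ ε q x').inf' (Qeps_nonempty h hh L τ ε hcov q x')
          (fun q' => Vbar h hh L τ ε (Qeps_nonempty h hh L τ ε hcov) That F δ H ρ n (x', q')))
    (hsel_notF : ∀ n ≤ H, ∀ (q : Q) (x' : Xh),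
      (∃ q' ∈ Qeps h hh L τ ε q x', q' ∉ F) → qsel n (q, x') ∉ F) :
    1 - Vbar h hh L τ ε (Qeps_nonempty h hh L τ ε hcov) That F δ H ρ H (xh0, qb0) =
      (1 - δ) ^ (k + 1) *
        (∑ s ∈ Finset.univ.filter
            (fun s : Fin k → Xh => AdmissibleR h hh L τ F ε qsel H xh0 qb0 s),
          (∏ z ∈ Finset.Icc 1 k,
            That (extSeq xh0 s (z - 1))
              (ρ (z - 1) (extSeq xh0 s (z - 1), qpath qsel H qb0 (extSeq xh0 s) (z - 1)))
              (extSeq xh0 s z)) *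
          (1 - ∑ x' : Xh,
            Vbar h hh L τ ε (Qeps_nonempty h hh L τ ε hcov) That F δ H ρ (H - k - 1)
                (x', qsel (H - k - 1) (qpath qsel H qb0 (extSeq xh0 s) k, x')) *
              That (extSeq xh0 s k)
                (ρ k (extSeq xh0 s k, qpath qsel H qb0 (extSeq xh0 s) k)) x')) +
      δ * ∑ j ∈ Finset.range (k + 1), (1 - δ) ^ j *
        ∑ s ∈ Finset.univ.filter
            (fun s : Fin j → Xh => AdmissibleR h hh L τ F ε qsel H xh0 qb0 s),
          ∏ z ∈ Finset.Icc 1 j,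
            That (extSeq xh0 s (z - 1))
              (ρ (z - 1) (extSeq xh0 s (z - 1), qpath qsel H qb0 (extSeq xh0 s) (z - 1)))
              (extSeq xh0 s z) := by
  set V := Vbar h hh L τ ε (Qeps_nonempty h hh L τ ε hcov) That F δ H ρ with hV
  let P : ∀ j : ℕ, (Fin j → Xh) → ℝ := fun j s => ∏ z ∈ Finset.Icc 1 j,
            That (extSeq xh0 s (z - 1))
              (ρ (z - 1) (extSeq xh0 s (z - 1), qpath qsel H qb0 (extSeq xh0 s) (z - 1)))
              (extSeq xh0 s z)
  let I : ∀ j : ℕ, (Fin j → Xh) → ℝ := fun j s => 1 - ∑ x' : Xh,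
            V (H - j - 1) (x', qsel (H - j - 1) (qpath qsel H qb0 (extSeq xh0 s) j, x')) *
              That (extSeq xh0 s j)
                (ρ j (extSeq xh0 s j, qpath qsel H qb0 (extSeq xh0 s) j)) x'
  let Ad : ∀ j : ℕ, Finset (Fin j → Xh) := fun j => Finset.univ.filter
            (fun s : Fin j → Xh => AdmissibleR h hh L τ F ε qsel H xh0 qb0 s)
  let D : ℕ → ℝ := fun j => ∑ s ∈ Ad j, P j s *
    (1 - V (H - j) (extSeq xh0 s j, qpath qsel H qb0 (extSeq xh0 s) j))
  have hVF : ∀ n x q, q ∈ F → V n (x, q) = 1 := by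
    intro n x q hq
    rw [hV]
    cases n <;> simp [Vbar, hq]
  have hVn : ∀ j < H, ∀ x q, q ∉ F → V (H - j) (x, q) =
      (1 - δ) * ∑ x' : Xh, V (H - j - 1) (x', qsel (H - j - 1) (q, x')) *
        That x (ρ j (x, q)) x' := by
    intro j hj x q hq
    obtain ⟨n, hn⟩ : ∃ n, H - j = n + 1 := ⟨H - j - 1, by omega⟩
    have hj2 : j = H - n - 1 := by omega
    rw [hn, Nat.add_sub_cancel]
    conv_lhs => rw [hV, Vbar]
    rw [if_neg hq]
    congr 1
    refine Finset.sum_congr rfl fun x' _ => ?_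
    rw [hsel_min n (by omega), hj2]
  have hXq : ∀ n ≤ H, ∀ q x', x' ∈ Xeps h hh L τ F ε q → qsel n (q, x') ∉ F := by
    intro n hn q x' hx
    obtain ⟨x, hx1, hx2⟩ := (Finset.mem_filter.1 hx).2
    exact hsel_notF n hn q x' ⟨_, Finset.mem_filter.2 ⟨Finset.mem_univ _, x, rfl, hx2⟩, hx1⟩
  have hXq' : ∀ n ≤ H, ∀ q x', x' ∉ Xeps h hh L τ F ε q → qsel n (q, x') ∈ F := by
    intro n hn q x' hx
    by_contra hc
    obtain ⟨x, hx1, hx2⟩ := (Finset.mem_filter.1 (hsel_mem n hn q x')).2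
    exact hx (Finset.mem_filter.2 ⟨Finset.mem_univ _, x, hx1 ▸ hc, hx2⟩)
  have hAF : ∀ j, ∀ s ∈ Ad j, qpath qsel H qb0 (extSeq xh0 s) j ∉ F := by
    intro j s hs
    have hs := (Finset.mem_filter.1 hs).2
    cases j with
    | zero => exact hq0
    | succ j =>
      simp only [qpath]
      exact hXq _ (by omega) _ _ (hs (j + 1) (by omega) le_rfl)
  have hD : ∀ j < H, D j = δ * ∑ s ∈ Ad j, P j s + (1 - δ) * ∑ s ∈ Ad j, P j s * I j s := by
    intro j hj
    simp only [D]
    rw [Finset.mul_sum, Finset.mul_sum, ← Finset.sum_add_distrib]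
    refine Finset.sum_congr rfl fun s hs => ?_
    rw [hVn j hj _ _ (hAF j s hs)]
    simp only [I]
    ring
  have hS : ∀ j < H, ∑ s ∈ Ad j, P j s * I j s = D (j + 1) := by
    intro j hj
    simp only [D, Ad]
    rw [Finset.sum_filter, Finset.sum_filter, sum_snoc12]
    refine Finset.sum_congr rfl fun s _ => ?_
    by_cases hs : AdmissibleR h hh L τ F ε qsel H xh0 qb0 s
    · rw [if_pos hs]
      have hI : I j s = ∑ x' : Xh,
          (1 - V (H - j - 1) (x', qsel (H - j - 1) (qpath qsel H qb0 (extSeq xh0 s) j, x'))) *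
              That (extSeq xh0 s j)
                (ρ j (extSeq xh0 s j, qpath qsel H qb0 (extSeq xh0 s) j)) x' := by
        simp only [I, sub_mul, one_mul, Finset.sum_sub_distrib, hT1]
      rw [hI, Finset.mul_sum]
      refine Finset.sum_congr rfl fun x _ => ?_
      rw [extSeq_last12, qpath_last12]
      simp only [adm_snoc12, hs, true_and, Nat.sub_sub]
      split_ifs with hx
      · have hP : P (j + 1) (Fin.snoc (α := fun _ => Xh) s x) = P j s *
            That (extSeq xh0 s j)
                (ρ j (extSeq xh0 s j, qpath qsel H qb0 (extSeq xh0 s) j)) x := by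
          simp only [P]
          rw [Finset.prod_Icc_succ_top (by omega), extSeq_last12, Nat.add_sub_cancel,
            extSeq_snoc12 _ _ _ _ le_rfl, qpath_snoc12 _ _ _ _ _ _ _ le_rfl]
          congr 1
          refine Finset.prod_congr rfl fun z hz => ?_
          rw [Finset.mem_Icc] at hz
          rw [extSeq_snoc12 _ _ _ _ hz.2, extSeq_snoc12 _ _ _ (z - 1) (by omega),
            qpath_snoc12 _ _ _ _ _ _ _ (by omega)]
        rw [hP]; ring
      · rw [hVF _ _ _ (hXq' _ (by omega) _ _ hx)]
        ring
    · simp [hs, adm_snoc12]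
  have hD0 : 1 - V H (xh0, qb0) = D 0 := by
    have h0 : ∀ s : Fin 0 → Xh, AdmissibleR h hh L τ F ε qsel H xh0 qb0 s :=
      fun s z h1 h2 => by omega
    simp [D, Ad, P, h0, extSeq, qpath]
  have key : ∀ k < H, 1 - V H (xh0, qb0) =
      (1 - δ) ^ (k + 1) * ∑ s ∈ Ad k, P k s * I k s +
        δ * ∑ j ∈ Finset.range (k + 1), (1 - δ) ^ j * ∑ s ∈ Ad j, P j s := by
    intro k
    induction k with
    | zero =>
      intro hk
      rw [hD0, hD 0 hk]
      simp only [zero_add, pow_one, Finset.sum_range_one, pow_zero, one_mul]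
      ring
    | succ k ih =>
      intro hk
      rw [ih (by omega), hS k (by omega), hD (k + 1) hk, Finset.sum_range_succ _ (k + 1)]
      ring
  exact key k hk


end
end

section
/- Fix x̂₀ ∈ X̂, q̄₀ ∈ Q with q̄₀ ∉ F, a Markov policy ρ over horizon H ≥ 1, and 0 ≤ k ≤ H−1. For a sequence (x̂(1), …, x̂(k)) ∈ X̂^k set x̂(0) := x̂₀, q(0) := q̄₀ and recursively q(z) := q̄_{H−z}(q(z−1), x̂(z)), and call the sequence admissible if x̂(z) ∈ X̂'_{−ε}(q(z−1)) for all 1 ≤ z ≤ k. Then 1 − V̲^ρ_H(x̂₀, q̄₀) = (1−δ)^{k+1} · ∑_{admissible (x̂(1),…,x̂(k))} (∏_{z=1}^{k} T̂ (x̂(z−1)) (ρ_{z−1}(x̂(z−1), q(z−1))) (x̂(z))) · (1 − ∑_{x̂' ∈ X̂} V̲^ρ_{H−k−1}(x̂', q̄_{H−k−1}(q(k), x̂')) · T̂ (x̂(k)) (ρ_k(x̂(k), q(k))) x̂') (the k-step expansion identity established in the proof of Theorem 4 of the paper). -/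
set_option autoImplicit false

open Finset MeasureTheory

attribute [local instance] Classical.propDecidable

noncomputable section

variable {p : ℕ} {X Xh A Q U : Type*}

/-- Admissibility of a sequence `(x̂(1),…, x̂(k))`: `x̂(z) ∈ X̂'_{−ε}(q(z−1))` for all `1 ≤ z ≤ k`. -/
def AdmissibleV [Fintype Q] [Fintype Xh]
    (h : X → EuclideanSpace ℝ (Fin p)) (hh : Xh → EuclideanSpace ℝ (Fin p))
    (L : EuclideanSpace ℝ (Fin p) → A) (τ : Q → A → Q) (F : Set Q) (ε : ℝ)
    (qsel : ℕ → Q × Xh → Q) (H : ℕ) (xh0 : Xh) (qb0 : Q) {k : ℕ}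
    (s : Fin k → Xh) : Prop :=
  ∀ z, 1 ≤ z → z ≤ k →
    extSeq xh0 s z ∈ Xmeps h hh L τ F ε (qpath qsel H qb0 (extSeq xh0 s) (z - 1))

lemma aux_ext_le (xh0 : Xh) {k : ℕ} (s : Fin k → Xh) (x : Xh) (z : ℕ) (hz : z ≤ k) :
    extSeq xh0 (Fin.snoc s x : Fin (k+1) → Xh) z = extSeq xh0 s z := by
  unfold extSeq
  by_cases h1 : 1 ≤ z
  · rw [dif_pos ⟨h1, by omega⟩, dif_pos ⟨h1, hz⟩]
    have : (⟨z - 1, by omega⟩ : Fin (k+1)) = Fin.castSucc ⟨z - 1, by omega⟩ := rfl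
    rw [this, Fin.snoc_castSucc (α := fun _ => Xh)]
  · rw [dif_neg (by omega), dif_neg (by omega)]

lemma aux_ext_last (xh0 : Xh) {k : ℕ} (s : Fin k → Xh) (x : Xh) :
    extSeq xh0 (Fin.snoc s x : Fin (k+1) → Xh) (k+1) = x := by
  unfold extSeq
  rw [dif_pos ⟨by omega, le_rfl⟩]
  have : (⟨k + 1 - 1, by omega⟩ : Fin (k+1)) = Fin.last k := rfl
  rw [this, Fin.snoc_last (α := fun _ => Xh)]

lemma aux_qpath (qsel : ℕ → Q × Xh → Q) (H : ℕ) (q0 : Q) (xs ys : ℕ → Xh) (k : ℕ)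
    (hxy : ∀ z ≤ k, xs z = ys z) : ∀ z ≤ k, qpath qsel H q0 xs z = qpath qsel H q0 ys z := by
  intro z
  induction z with
  | zero => intro _; rfl
  | succ z ih =>
    intro hz
    simp only [qpath]
    rw [ih (by omega), hxy _ hz]

lemma aux_V_le [Fintype Q] [Fintype Xh]
    (h : X → EuclideanSpace ℝ (Fin p)) (hh : Xh → EuclideanSpace ℝ (Fin p))
    (L : EuclideanSpace ℝ (Fin p) → A) (τ : Q → A → Q) (ε : ℝ)
    (hQ : ∀ (q : Q) (x' : Xh), (Qeps h hh L τ ε q x').Nonempty)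
    (That : Xh → U → Xh → ℝ) (F : Set Q) (δ : ℝ) (H : ℕ) (ρ : ℕ → Xh × Q → U)
    (hδ1 : δ ≤ 1)
    (hT0 : ∀ xh u xh', 0 ≤ That xh u xh')
    (hT1 : ∀ xh u, ∑ xh' : Xh, That xh u xh' = 1) (n : ℕ) :
    ∀ s, Vunder h hh L τ ε hQ That F δ H ρ n s ≤ 1 := by
  induction n with
  | zero => intro s; simp only [Vunder]; split_ifs <;> norm_num
  | succ n ih =>
    intro s
    simp only [Vunder]
    split_ifs
    · exact le_rfl
    · have : ∑ x' : Xh, ((Qeps h hh L τ ε s.2 x').sup' (hQ s.2 x')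
          fun q' => Vunder h hh L τ ε hQ That F δ H ρ n (x', q'))
        * That s.1 (ρ (H - n - 1) s) x' ≤ 1 := by
        rw [← hT1 s.1 (ρ (H - n - 1) s)]
        refine Finset.sum_le_sum fun x' _ => ?_
        have := Finset.sup'_le (hQ s.2 x')
          (fun q' => Vunder h hh L τ ε hQ That F δ H ρ n (x', q')) (fun q' _ => ih (x', q'))
        exact mul_le_of_le_one_left (hT0 _ _ _) this
      nlinarith

theorem statement13
    (hp : 1 ≤ p) [Nonempty X] [Fintype Xh] [Nonempty Xh] [Fintype A] [Fintype Q]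
    [Fintype U] [Nonempty U]
    (h : X → EuclideanSpace ℝ (Fin p)) (hh : Xh → EuclideanSpace ℝ (Fin p))
    (L : EuclideanSpace ℝ (Fin p) → A) (τ : Q → A → Q) (F : Set Q)
    (ε δ : ℝ) (hε : 0 ≤ ε) (hδ0 : 0 ≤ δ) (hδ1 : δ ≤ 1)
    (hcov : ∀ x' : Xh, ∃ x : X, ‖h x - hh x'‖ ≤ ε)
    (That : Xh → U → Xh → ℝ)
    (hT0 : ∀ xh u xh', 0 ≤ That xh u xh')
    (hT1 : ∀ xh u, ∑ xh' : Xh, That xh u xh' = 1)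
    (H : ℕ) (hH : 1 ≤ H) (ρ : ℕ → Xh × Q → U)
    (xh0 : Xh) (qb0 : Q) (hq0 : qb0 ∉ F) (k : ℕ) (hk : k < H)
    (qsel : ℕ → Q × Xh → Q)
    (hsel_mem : ∀ n ≤ H, ∀ (q : Q) (x' : Xh), qsel n (q, x') ∈ Qeps h hh L τ ε q x')
    (hsel_max : ∀ n ≤ H, ∀ (q : Q) (x' : Xh),
      Vunder h hh L τ ε (Qeps_nonempty h hh L τ ε hcov) That F δ H ρ n (x', qsel n (q, x')) =
        (Qeps h hh L τ ε q x').sup' (Qeps_nonempty h hh L τ ε hcov q x')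
          (fun q' => Vunder h hh L τ ε (Qeps_nonempty h hh L τ ε hcov) That F δ H ρ n (x', q'))) :
    1 - Vunder h hh L τ ε (Qeps_nonempty h hh L τ ε hcov) That F δ H ρ H (xh0, qb0) =
      (1 - δ) ^ (k + 1) *
        ∑ s ∈ Finset.univ.filter
            (fun s : Fin k → Xh => AdmissibleV h hh L τ F ε qsel H xh0 qb0 s),
          (∏ z ∈ Finset.Icc 1 k,
            That (extSeq xh0 s (z - 1))
              (ρ (z - 1) (extSeq xh0 s (z - 1), qpath qsel H qb0 (extSeq xh0 s) (z - 1)))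
              (extSeq xh0 s z)) *
          (1 - ∑ x' : Xh,
            Vunder h hh L τ ε (Qeps_nonempty h hh L τ ε hcov) That F δ H ρ (H - k - 1)
                (x', qsel (H - k - 1) (qpath qsel H qb0 (extSeq xh0 s) k, x')) *
              That (extSeq xh0 s k)
                (ρ k (extSeq xh0 s k, qpath qsel H qb0 (extSeq xh0 s) k)) x') := by
  classical
  set V := Vunder h hh L τ ε (Qeps_nonempty h hh L τ ε hcov) That F δ H ρ with hV
  have hVle : ∀ n s, V n s ≤ 1 := fun n s =>
    aux_V_le h hh L τ ε (Qeps_nonempty h hh L τ ε hcov) That F δ H ρ hδ1 hT0 hT1 n s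
  have hrec : ∀ k, k < H → ∀ x q, q ∉ F → 1 - V (H - k) (x, q) =
      (1 - δ) * (1 - ∑ x' : Xh, V (H - k - 1) (x', qsel (H - k - 1) (q, x')) *
        That x (ρ k (x, q)) x') := by
    intro k hk x q hq
    obtain ⟨m, hm⟩ : ∃ m, H - k = m + 1 := ⟨H - k - 1, by omega⟩
    have e1 : H - k - 1 = m := by omega
    have e2 : H - m - 1 = k := by omega
    have e3 : V (m+1) (x, q) = (1 - δ) * (∑ x' : Xh, V m (x', qsel m (q, x')) *
        That x (ρ k (x, q)) x') + δ := by
      simp only [hsel_max m (by omega)]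
      rw [hV, Vunder, if_neg hq, e2]
    rw [e1, hm, e3]
    ring
  have hgood : ∀ n ≤ H, ∀ q x', x' ∈ Xmeps h hh L τ F ε q → qsel n (q, x') ∉ F := by
    intro n hn q x' hx'
    obtain ⟨x, hx1, hx2⟩ := (Finset.mem_filter.1 (hsel_mem n hn q x')).2
    rw [hx1]
    exact (Finset.mem_filter.1 hx').2 x hx2
  have hVF : ∀ n x q, q ∈ F → V n (x, q) = 1 := by
    intro n x q hq
    cases n <;> rw [hV, Vunder, if_pos hq]
  have hbad : ∀ n ≤ H, ∀ q x', x' ∉ Xmeps h hh L τ F ε q → V n (x', qsel n (q, x')) = 1 := by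
    intro n hn q x' hx'
    have : ∃ x : X, ‖h x - hh x'‖ ≤ ε ∧ τ q (L (h x)) ∈ F := by
      by_contra hc
      push Not at hc
      exact hx' (Finset.mem_filter.2 ⟨Finset.mem_univ _, hc⟩)
    obtain ⟨x, hx1, hx2⟩ := this
    refine le_antisymm (hVle _ _) ?_
    rw [hsel_max n hn, ← hVF n x' _ hx2]
    exact Finset.le_sup' (fun q' => V n (x', q'))
      (Finset.mem_filter.2 ⟨Finset.mem_univ _, x, rfl, hx1⟩)
  have hstep : ∀ k, k + 1 < H → ∀ x q,
      1 - ∑ x' : Xh, V (H - k - 1) (x', qsel (H - k - 1) (q, x')) * That x (ρ k (x, q)) x' =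
      (1 - δ) * ∑ x' : Xh, if x' ∈ Xmeps h hh L τ F ε q then That x (ρ k (x, q)) x' *
        (1 - ∑ x'' : Xh, V (H - (k+1) - 1)
          (x'', qsel (H - (k+1) - 1) (qsel (H - (k+1)) (q, x'), x'')) *
          That x' (ρ (k+1) (x', qsel (H - (k+1)) (q, x'))) x'') else 0 := by
    intro k hk x q
    nth_rewrite 1 [← hT1 x (ρ k (x, q))]
    rw [← Finset.sum_sub_distrib, Finset.mul_sum]
    refine Finset.sum_congr rfl fun x' _ => ?_
    have e : H - k - 1 = H - (k+1) := by omega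
    rw [e]
    split_ifs with hx'
    · have := hrec (k+1) hk x' _ (hgood (H - (k+1)) (by omega) q x' hx')
      linear_combination (That x (ρ k (x, q)) x') * this
    · rw [hbad _ (by omega) q x' hx']; ring
  induction k with
  | zero =>
    have := hrec 0 hk xh0 qb0 hq0
    rw [Finset.filter_true_of_mem (by intro s _ z h1 h2; omega)]
    simpa [extSeq, qpath] using this
  | succ k ih =>
    rw [ih (by omega), pow_succ _ (k+1), mul_assoc]
    congr 1
    rw [Finset.sum_filter, Finset.sum_filter,
      ← (Fin.snocEquiv (fun _ : Fin (k+1) => Xh)).sum_comp, Fintype.sum_prod_type,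
      Finset.sum_comm, Finset.mul_sum]
    refine Finset.sum_congr rfl fun s _ => ?_
    have hx : ∀ x, ∀ z ≤ k, extSeq xh0 (Fin.snoc s x : Fin (k+1) → Xh) z = extSeq xh0 s z :=
      fun x z hz => aux_ext_le xh0 s x z hz
    have hq : ∀ x, ∀ z ≤ k, qpath qsel H qb0 (extSeq xh0 (Fin.snoc s x : Fin (k+1) → Xh)) z =
        qpath qsel H qb0 (extSeq xh0 s) z := fun x => aux_qpath qsel H qb0 _ _ k (hx x)
    have hl : ∀ x, extSeq xh0 (Fin.snoc s x : Fin (k+1) → Xh) (k+1) = x := aux_ext_last xh0 s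
    have hql : ∀ x, qpath qsel H qb0 (extSeq xh0 (Fin.snoc s x : Fin (k+1) → Xh)) (k+1) =
        qsel (H - (k+1)) (qpath qsel H qb0 (extSeq xh0 s) k, x) := by
      intro x
      rw [qpath, hq x k le_rfl, hl]
    have hadm : ∀ x, AdmissibleV h hh L τ F ε qsel H xh0 qb0 (Fin.snoc s x : Fin (k+1) → Xh) ↔
        AdmissibleV h hh L τ F ε qsel H xh0 qb0 s ∧
          x ∈ Xmeps h hh L τ F ε (qpath qsel H qb0 (extSeq xh0 s) k) := by
      intro x
      constructor
      · intro ha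
        refine ⟨fun z h1 h2 => ?_, ?_⟩
        · have := ha z h1 (by omega)
          rwa [hx x z h2, hq x (z-1) (by omega)] at this
        · have := ha (k+1) (by omega) le_rfl
          rwa [hl, Nat.add_sub_cancel, hq x k le_rfl] at this
      · rintro ⟨ha, hb⟩ z h1 h2
        rcases Nat.lt_or_ge k z with h3 | h3
        · obtain rfl : z = k + 1 := by omega
          rwa [hl, Nat.add_sub_cancel, hq x k le_rfl]
        · rw [hx x z h3, hq x (z-1) (by omega)]
          exact ha z h1 h3
    have hsn : ∀ x, (Fin.snocEquiv (fun _ : Fin (k+1) => Xh)) (x, s) =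
      (Fin.snoc s x : Fin (k+1) → Xh) := fun x => rfl
    simp only [hsn, hadm, hql, hl]
    by_cases ha : AdmissibleV h hh L τ F ε qsel H xh0 qb0 s
    · simp only [ha, true_and, if_true]
      rw [hstep k hk, mul_left_comm, Finset.mul_sum]
      congr 1
      refine Finset.sum_congr rfl fun x _ => ?_
      rw [mul_ite, mul_zero]
      congr 1
      rw [Finset.prod_Icc_succ_top (by omega), Nat.add_sub_cancel, hx x k le_rfl,
        hq x k le_rfl, hl, ← mul_assoc]
      congr 2
      refine Finset.prod_congr rfl fun z hz => ?_
      have := Finset.mem_Icc.1 hz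
      rw [hx x z this.2, hx x (z-1) (by omega), hq x (z-1) (by omega)]
    · simp [ha]

end
end
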